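/- Let d > 1 be a squarefree positive integer and let O_d be the ring of integers of the real quadratic field ℚ(√d). Then SL₂(O_d)^ab is isomorphic to: 0 if d ≡ 5 (mod 24); (ℤ/4)² ⊕ (ℤ/3)² if d ≡ 1 (mod 24); (ℤ/4)² ⊕ ℤ/3 if d ≡ 9 (mod 24); (ℤ/3)² if d ≡ 13 (mod 24); ℤ/3 if d ≡ 21 (mod 24); (ℤ/4)² if d ≡ 17 (mod 24); (ℤ/2)² if d ≡ 2, 11, 14, 20, or 23 (mod 24); (ℤ/2)² ⊕ (ℤ/3)² if d ≡ 4, 7, 10, 19, or 22 (mod 24); and (ℤ/2)² ⊕ ℤ/3 in all remaining cases. -/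

import Mathlib

open NumberField

/-- The abelianization of `SL₂(R)`, written additively. -/
abbrev SL2ab (R : Type*) [CommRing R] : Type _ :=
  Additive (Abelianization (Matrix.SpecialLinearGroup (Fin 2) R))

open Matrix

section StableRange

variable {R : Type*} [CommRing R]

/-- A finite commutative ring has stable range one. -/
theorem exists_isUnit_add_mul_of_finite [Finite R] {a b : R} (h : IsCoprime a b) :
    ∃ t : R, IsUnit (b + t * a) := by
  obtain ⟨n, hn, he⟩ : ∃ n : ℕ, 0 < n ∧ IsIdempotentElem (b ^ n) := by
    obtain ⟨i, j, hne, hij⟩ := Finite.exists_ne_map_eq_of_infinite (fun n : ℕ => b ^ n)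
    wlog hlt : i < j generalizing i j
    · exact this j i hne.symm hij.symm (by omega)
    obtain ⟨k, rfl⟩ := Nat.exists_eq_add_of_lt hlt
    have hper : ∀ m, b ^ (i + m * (k + 1)) = b ^ i := by
      intro m
      induction m with
      | zero => simp
      | succ m ih =>
        have : i + (m + 1) * (k + 1) = (k + 1) + (i + m * (k + 1)) := by ring
        rw [this, pow_add, ih, ← pow_add]
        have h2 : b ^ i = b ^ (i + k + 1) := hij
        rw [h2]; congr 1; ring
    refine ⟨(i + 1) * (k + 1), by positivity, ?_⟩
    have h1 : i ≤ (i + 1) * (k + 1) := by nlinarith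
    obtain ⟨r, hr⟩ := Nat.exists_eq_add_of_le h1
    have h2 := hper (i + 1)
    unfold IsIdempotentElem
    rw [← pow_add]
    calc b ^ ((i + 1) * (k + 1) + (i + 1) * (k + 1))
        = b ^ (i + (i + 1) * (k + 1)) * b ^ r := by rw [← pow_add]; congr 1; omega
      _ = b ^ i * b ^ r := by rw [h2]
      _ = b ^ ((i + 1) * (k + 1)) := by rw [← pow_add, hr]
  refine ⟨1 - b ^ n, ?_⟩
  by_contra hu
  obtain ⟨m, hm, hmem⟩ := exists_max_ideal_of_mem_nonunits hu
  have hp := hm.isPrime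
  by_cases hb : b ∈ m
  · have hbn : b ^ n ∈ m := m.pow_mem_of_mem hb n hn
    have h1 : (1 - b ^ n) * a ∈ m := (m.add_mem_iff_right hb).1 hmem
    rcases hp.mem_or_mem h1 with h2 | h2
    · exact hp.ne_top ((Ideal.eq_top_iff_one _).2 (by simpa using m.add_mem h2 hbn))
    · obtain ⟨u, v, huv⟩ := h
      exact hp.ne_top ((Ideal.eq_top_iff_one _).2
        (huv ▸ m.add_mem (m.mul_mem_left u h2) (m.mul_mem_left v hb)))
  · have h1 : b ^ n * (1 - b ^ n) ∈ m := by
      rw [mul_sub, mul_one, he.eq, sub_self]; exact m.zero_mem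
    rcases hp.mem_or_mem h1 with h2 | h2
    · exact hb (hp.mem_of_pow_mem _ h2)
    · exact hb ((m.add_mem_iff_left (m.mul_mem_right a h2)).1 hmem)

/-- If `a, b, N` generate the unit ideal and `R / N` is finite then `b` can be moved by a multiple
of `a` to an element coprime to `N`. -/
theorem exists_isCoprime_add_mul {a b N : R} [Finite (R ⧸ Ideal.span {N})]
    (h : ∃ u v w, u * a + v * b + w * N = 1) : ∃ t : R, IsCoprime (b + t * a) N := by
  obtain ⟨u, v, w, h⟩ := h
  let π := Ideal.Quotient.mk (Ideal.span {N})
  have hN : π N = 0 := Ideal.Quotient.eq_zero_iff_mem.2 (Ideal.mem_span_singleton_self N)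
  have hc : IsCoprime (π a) (π b) := ⟨π u, π v, by
    have := congrArg π h
    simpa [hN] using this⟩
  obtain ⟨t, ht⟩ := exists_isUnit_add_mul_of_finite hc
  obtain ⟨t, rfl⟩ := Ideal.Quotient.mk_surjective t
  obtain ⟨s, hs⟩ := ht.exists_left_inv
  obtain ⟨s, rfl⟩ := Ideal.Quotient.mk_surjective s
  refine ⟨t, ?_⟩
  have h3 : π (s * (b + t * a) - 1) = 0 := by
    have h4 : π s * (π b + π t * π a) = 1 := hs
    simp [h4]
  obtain ⟨r, hr⟩ := Ideal.mem_span_singleton'.1 (Ideal.Quotient.eq_zero_iff_mem.1 h3)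
  exact ⟨s, -r, by linear_combination -hr⟩

end StableRange

section Elementary

variable {R : Type*} [CommRing R]

/-- The matrix `!![a, b; c, d]` as an element of `SL₂(R)`. -/
def sl2mk (a b c d : R) (h : a * d - b * c = 1) : SpecialLinearGroup (Fin 2) R :=
  ⟨!![a, b; c, d], by rw [det_fin_two_of, h]⟩

/-- The upper triangular elementary matrix. -/
def upperElem (x : R) : SpecialLinearGroup (Fin 2) R := sl2mk 1 x 0 1 (by ring)

/-- The lower triangular elementary matrix. -/
def lowerElem (x : R) : SpecialLinearGroup (Fin 2) R := sl2mk 1 0 x 1 (by ring)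

theorem sl2_det (M : SpecialLinearGroup (Fin 2) R) : M 0 0 * M 1 1 - M 0 1 * M 1 0 = 1 := by
  have := M.2; rwa [det_fin_two] at this

theorem sl2_ext {M N : SpecialLinearGroup (Fin 2) R} (h00 : M 0 0 = N 0 0) (h01 : M 0 1 = N 0 1)
    (h10 : M 1 0 = N 1 0) (h11 : M 1 1 = N 1 1) : M = N := by
  ext i j; fin_cases i <;> fin_cases j <;> assumption

@[simp] theorem sl2mk_00 (a b c d : R) (h) : sl2mk a b c d h 0 0 = a := rfl
@[simp] theorem sl2mk_01 (a b c d : R) (h) : sl2mk a b c d h 0 1 = b := rfl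
@[simp] theorem sl2mk_10 (a b c d : R) (h) : sl2mk a b c d h 1 0 = c := rfl
@[simp] theorem sl2mk_11 (a b c d : R) (h) : sl2mk a b c d h 1 1 = d := rfl

theorem sl2_mul_apply (M N : SpecialLinearGroup (Fin 2) R) (i j : Fin 2) :
    (M * N) i j = M i 0 * N 0 j + M i 1 * N 1 j := by
  change (M.1 * N.1) i j = _
  rw [mul_apply, Fin.sum_univ_two]

@[simp] theorem upperElem_00 (x : R) : upperElem x 0 0 = 1 := rfl
@[simp] theorem upperElem_01 (x : R) : upperElem x 0 1 = x := rfl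
@[simp] theorem upperElem_10 (x : R) : upperElem x 1 0 = 0 := rfl
@[simp] theorem upperElem_11 (x : R) : upperElem x 1 1 = 1 := rfl
@[simp] theorem lowerElem_00 (x : R) : lowerElem x 0 0 = 1 := rfl
@[simp] theorem lowerElem_01 (x : R) : lowerElem x 0 1 = 0 := rfl
@[simp] theorem lowerElem_10 (x : R) : lowerElem x 1 0 = x := rfl
@[simp] theorem lowerElem_11 (x : R) : lowerElem x 1 1 = 1 := rfl

@[simp] theorem sl2_one_00 : (1 : SpecialLinearGroup (Fin 2) R) 0 0 = 1 := rfl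
@[simp] theorem sl2_one_01 : (1 : SpecialLinearGroup (Fin 2) R) 0 1 = 0 := rfl
@[simp] theorem sl2_one_10 : (1 : SpecialLinearGroup (Fin 2) R) 1 0 = 0 := rfl
@[simp] theorem sl2_one_11 : (1 : SpecialLinearGroup (Fin 2) R) 1 1 = 1 := rfl

theorem upperElem_add (x y : R) : upperElem (x + y) = upperElem x * upperElem y := by
  apply sl2_ext <;> simp [sl2_mul_apply, add_comm]

theorem lowerElem_add (x y : R) : lowerElem (x + y) = lowerElem x * lowerElem y := by
  apply sl2_ext <;> simp [sl2_mul_apply]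

@[simp] theorem upperElem_zero : upperElem (0 : R) = 1 := by apply sl2_ext <;> simp

@[simp] theorem lowerElem_zero : lowerElem (0 : R) = 1 := by apply sl2_ext <;> simp

/-- The subgroup generated by elementary matrices. -/
def elemSubgroup (R : Type*) [CommRing R] : Subgroup (SpecialLinearGroup (Fin 2) R) :=
  Subgroup.closure (Set.range upperElem ∪ Set.range lowerElem)

theorem upperElem_mem (x : R) : upperElem x ∈ elemSubgroup R :=
  Subgroup.subset_closure (Or.inl ⟨x, rfl⟩)

theorem lowerElem_mem (x : R) : lowerElem x ∈ elemSubgroup R :=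
  Subgroup.subset_closure (Or.inr ⟨x, rfl⟩)

theorem diag_eq_elem {u v : R} (h : u * v = 1) :
    sl2mk u 0 0 v (by simp [h]) = upperElem u * lowerElem (-v) * upperElem u *
      (upperElem (-1) * lowerElem 1 * upperElem (-1)) := by
  apply sl2_ext <;> simp [sl2_mul_apply]
  · linear_combination (-u) * h
  · linear_combination -h
  · linear_combination h

theorem elemSubgroup_eq_top_of_finite [Finite R] : elemSubgroup R = ⊤ := by
  rw [eq_top_iff]
  intro M _
  have hdet := sl2_det M
  obtain ⟨t, ht⟩ := exists_isUnit_add_mul_of_finite (a := M 0 1) (b := M 0 0)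
    ⟨-M 1 0, M 1 1, by linear_combination hdet⟩
  obtain ⟨s, hs⟩ := ht.exists_right_inv
  have key : M = lowerElem ((M 1 0 + t * M 1 1) * s) *
      sl2mk (M 0 0 + t * M 0 1) 0 0 s (by linear_combination hs) *
      upperElem (s * M 0 1) * lowerElem (-t) := by
    apply sl2_ext <;> simp [sl2_mul_apply]
    · linear_combination (t * M 0 1) * hs
    · linear_combination (-M 0 1) * hs
    · linear_combination (-(M 1 0 + t * M 1 1) +
        t * ((M 1 0 + t * M 1 1) * s * M 0 1 + M 1 1)) * hs - t * s * hdet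
    · linear_combination (-(M 1 0 + t * M 1 1) * s * M 0 1 - M 1 1) * hs + s * hdet
  rw [key, diag_eq_elem hs]
  exact mul_mem (mul_mem (mul_mem (lowerElem_mem _) (mul_mem (mul_mem (mul_mem (upperElem_mem _)
    (lowerElem_mem _)) (upperElem_mem _)) (mul_mem (mul_mem (upperElem_mem _)
    (lowerElem_mem _)) (upperElem_mem _)))) (upperElem_mem _)) (lowerElem_mem _)

end Elementary

section RelSymbol

variable {R A : Type*} [CommRing R] [CommGroup A] (φ : SpecialLinearGroup (Fin 2) R →* A)

/-- `upperElem` followed by a homomorphism. -/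
def elemHom : Multiplicative R →* A where
  toFun x := φ (upperElem x.toAdd)
  map_one' := by simp
  map_mul' x y := by rw [toAdd_mul, upperElem_add, map_mul]

theorem map_upperElem_add (x y : R) :
    φ (upperElem (x + y)) = φ (upperElem x) * φ (upperElem y) := by rw [upperElem_add, map_mul]

theorem map_upperElem_neg (x : R) : φ (upperElem (-x)) = (φ (upperElem x))⁻¹ :=
  map_inv (elemHom φ) (Multiplicative.ofAdd x)

theorem map_upperElem_sq {u v : R} (h : u * v = 1) (x : R) :
    φ (upperElem (u ^ 2 * x)) = φ (upperElem x) := by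
  have := congrArg φ (show sl2mk u 0 0 v (by simp [h]) * upperElem x =
    upperElem (u ^ 2 * x) * sl2mk u 0 0 v (by simp [h]) by
      apply sl2_ext <;> simp [sl2_mul_apply]
      linear_combination (-u * x) * h)
  rw [map_mul, map_mul, mul_comm] at this
  exact (mul_right_cancel this).symm

theorem map_lowerElem (x : R) : φ (lowerElem x) = φ (upperElem (-x)) := by
  have := congrArg φ (show sl2mk 0 1 (-1) 0 (by simp) * lowerElem x =
    upperElem (-x) * sl2mk 0 1 (-1) 0 (by simp) by
      apply sl2_ext <;> simp [sl2_mul_apply])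
  rw [map_mul, map_mul, mul_comm] at this
  exact mul_right_cancel this

variable (q : R)

open Classical in
/-- The value of `φ` at any matrix with first row `(a, q * β)` and lower left entry in `q R`. -/
noncomputable def relSym (a β : R) : A :=
  if h : ∃ M : SpecialLinearGroup (Fin 2) R, M 0 0 = a ∧ M 0 1 = q * β ∧ q ∣ M 1 0 then
    φ h.choose else 1

theorem map_diag {u v : R} (h : u * v = 1) :
    φ (sl2mk u 0 0 v (by simp [h])) = φ (upperElem (2 * u + v - 3)) := by
  rw [diag_eq_elem h]
  simp only [map_mul, map_lowerElem]
  simp only [← map_mul, ← upperElem_add]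
  congr 2
  ring

variable {φ q}
theorem exists_relSym {q a β : R} (ha : q ∣ a - 1) (h : IsCoprime a β) :
    ∃ M : SpecialLinearGroup (Fin 2) R, M 0 0 = a ∧ M 0 1 = q * β ∧ q ∣ M 1 0 ∧ q ∣ M 1 1 - 1 := by
  obtain ⟨k, hk⟩ := ha
  have h' : IsCoprime a (q * β) := .mul_right ⟨1, -k, by linear_combination hk⟩ h
  obtain ⟨x, y, hxy⟩ := h'
  refine ⟨sl2mk a (q * β) (y * (a - 1)) (x + y * (q * β)) (by linear_combination hxy), rfl, rfl,
    ?_, ?_⟩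
  · exact ⟨y * k, by simp; linear_combination y * hk⟩
  · exact ⟨-x * k, by simp; linear_combination hxy - x * hk⟩

variable (hq : ∀ x, φ (upperElem (q * x)) = 1)

include hq

theorem map_eq_relSym {a β : R} {M : SpecialLinearGroup (Fin 2) R} (h0 : M 0 0 = a)
    (h1 : M 0 1 = q * β) (h2 : q ∣ M 1 0) : φ M = relSym φ q a β := by
  have hex : ∃ M : SpecialLinearGroup (Fin 2) R, M 0 0 = a ∧ M 0 1 = q * β ∧ q ∣ M 1 0 :=
    ⟨M, h0, h1, h2⟩
  rw [relSym, dif_pos hex]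
  obtain ⟨g0, g1, c', g2⟩ := hex.choose_spec
  obtain ⟨c, h2⟩ := h2
  set N := hex.choose
  have hM := sl2_det M
  have hN := sl2_det N
  rw [h0, h1] at hM
  rw [g0, g1] at hN
  have : M = lowerElem (q * (c * N 1 1 - c' * M 1 1)) * N := by
    apply sl2_ext <;> simp only [sl2_mul_apply, lowerElem_00, lowerElem_01, lowerElem_10,
      lowerElem_11, h0, h1, g0, g1]
    · ring
    · ring
    · rw [g2] at hN ⊢
      rw [h2] at hM ⊢
      linear_combination (-q * c) * hN + q * c' * hM
    · rw [g2] at hN 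
      rw [h2] at hM
      linear_combination (- M 1 1) * hN + N 1 1 * hM
  rw [this, map_mul, map_lowerElem, ← mul_neg, hq, one_mul]

theorem relSym_add_left {a β : R} (ha : q ∣ a - 1) (h : IsCoprime a β) (t : R) :
    relSym φ q (a + q * β * t) β = relSym φ q a β := by
  obtain ⟨M, h0, h1, ⟨c, h2⟩, k, h3⟩ := exists_relSym ha h
  rw [← map_eq_relSym hq h0 h1 ⟨c, h2⟩]
  obtain ⟨l, ha⟩ := ha
  rw [← map_eq_relSym hq (M := lowerElem (-t) * M * lowerElem t)]
  · simp only [map_mul]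
    rw [mul_right_comm, ← map_mul, ← lowerElem_add]
    simp
  · simp [sl2_mul_apply, h0, h1]
  · simp [sl2_mul_apply, h0, h1]
  · refine ⟨c + k * t - t * l - t * β * t, ?_⟩
    simp [sl2_mul_apply, h0, h1, h2]
    linear_combination t * h3 - t * ha

theorem relSym_add_right {a β : R} (ha : q ∣ a - 1) (h : IsCoprime a β) (t : R) :
    relSym φ q a (β + a * t) = relSym φ q a β := by
  obtain ⟨M, h0, h1, ⟨c, h2⟩, k, h3⟩ := exists_relSym ha h
  rw [← map_eq_relSym hq h0 h1 ⟨c, h2⟩]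
  rw [← map_eq_relSym hq (M := M * upperElem (q * t))]
  · simp only [map_mul, hq, mul_one]
  · simp [sl2_mul_apply, h0]
  · simp [sl2_mul_apply, h0, h1]; ring
  · simp [sl2_mul_apply, h2]

theorem relSym_unit_sq_mul_right {a β u v : R} (ha : q ∣ a - 1) (h : IsCoprime a β)
    (huv : u * v = 1) : relSym φ q a (u ^ 2 * β) = relSym φ q a β := by
  obtain ⟨M, h0, h1, ⟨c, h2⟩, k, h3⟩ := exists_relSym ha h
  rw [← map_eq_relSym hq h0 h1 ⟨c, h2⟩]
  rw [← map_eq_relSym hq (M := sl2mk u 0 0 v (by simp [huv]) * M *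
    sl2mk v 0 0 u (by simp [mul_comm, huv]))]
  · simp only [map_mul]
    rw [mul_right_comm, ← map_mul, show sl2mk u 0 0 v (by simp [huv]) *
      sl2mk v 0 0 u (by simp [mul_comm, huv]) = 1 by
        apply sl2_ext <;> simp [sl2_mul_apply, huv, mul_comm v u]]
    simp
  · simp [sl2_mul_apply, h0]; linear_combination a * huv
  · simp [sl2_mul_apply, h1]; ring
  · simp [sl2_mul_apply, h2]
    exact ⟨v * c * v, by ring⟩

theorem relSym_unit_mul {a β u v : R} (ha : q ∣ a - 1) (h : IsCoprime a β)
    (huv : u * v = 1) (hu : q ∣ u - 1) : relSym φ q (u * a) (u * β) = relSym φ q a β := by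
  obtain ⟨M, h0, h1, ⟨c, h2⟩, k, h3⟩ := exists_relSym ha h
  rw [← map_eq_relSym hq h0 h1 ⟨c, h2⟩]
  obtain ⟨l, hu⟩ := hu
  rw [← map_eq_relSym hq (M := sl2mk u 0 0 v (by simp [huv]) * M)]
  · rw [map_mul, map_diag, show 2 * u + v - 3 = q * (2 * l - l * v) by
      linear_combination 2 * hu - v * hu + huv, hq, one_mul]
    exact huv
  · simp [sl2_mul_apply, h0]
  · simp [sl2_mul_apply, h1]; ring
  · simp [sl2_mul_apply, h2]
    exact ⟨v * c, by ring⟩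

theorem relSym_unit_sq_mul_left {a β u v : R} (ha : q ∣ a - 1) (h : IsCoprime a β)
    (huv : u * v = 1) (hu : q ∣ u ^ 2 - 1) :
    relSym φ q (u ^ 2 * a) β = relSym φ q a β := by
  have hU : u ^ 2 * v ^ 2 = 1 := by rw [← mul_pow, huv, one_pow]
  rw [← relSym_unit_mul hq ha h hU hu, relSym_unit_sq_mul_right hq _ _ huv]
  · obtain ⟨k, hk⟩ := ha
    obtain ⟨l, hl⟩ := hu
    exact ⟨l * a + k, by linear_combination a * hl + hk⟩
  · exact (isCoprime_mul_unit_left_left (IsUnit.of_mul_eq_one _ hU) _ _).2 h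

theorem relSym_unit {a u : R} (ha : q ∣ a - 1) (hu : IsUnit u) : relSym φ q a u = 1 := by
  obtain ⟨v, hv⟩ := hu.exists_right_inv
  obtain ⟨k, hk⟩ := ha
  have h1 := relSym_add_left hq (a := 1) (β := u) (by simp) isCoprime_one_left (v * k)
  rw [show 1 + q * u * (v * k) = a by linear_combination q * k * hv - hk] at h1
  rw [h1, ← hq u]
  exact (map_eq_relSym hq (by simp) (by simp) (by simp)).symm

end RelSymbol

section QuadRing

/-- The ring `ℤ[ω]` with `ω ^ 2 = a + b * ω`. -/
abbrev QuadRing (a b : ℤ) := QuadraticAlgebra ℤ a b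

variable {a b : ℤ}

open QuadraticAlgebra

theorem QuadRing.norm_apply (x : QuadRing a b) :
    QuadraticAlgebra.norm x = x.re * x.re + b * x.re * x.im - a * x.im * x.im := by
  simp [QuadraticAlgebra.norm_def]

theorem QuadRing.mul_star_self (x : QuadRing a b) :
    x * star x = ((QuadraticAlgebra.norm x : ℤ) : QuadRing a b) := by
  rw [← algebraMap_norm_eq_mul_star]; rfl

theorem QuadRing.dvd_norm (x : QuadRing a b) : x ∣ ((QuadraticAlgebra.norm x : ℤ) : QuadRing a b) :=
  ⟨star x, (mul_star_self x).symm⟩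

theorem QuadRing.norm_eq_zero (hns : ¬ IsSquare (b ^ 2 + 4 * a)) {x : QuadRing a b} :
    QuadraticAlgebra.norm x = 0 ↔ x = 0 := by
  refine ⟨fun h => ?_, fun h => by rw [h, QuadraticAlgebra.norm_zero]⟩
  rw [norm_apply] at h
  have h4 : (2 * x.re + b * x.im) ^ 2 = (b ^ 2 + 4 * a) * x.im ^ 2 := by linear_combination 4 * h
  have him : x.im = 0 := by
    by_contra him
    apply hns
    have hd : x.im ∣ 2 * x.re + b * x.im := by
      rw [← Int.pow_dvd_pow_iff two_ne_zero]
      exact ⟨_, h4.trans (mul_comm _ _)⟩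
    obtain ⟨c, hc⟩ := hd
    refine ⟨c, ?_⟩
    rw [hc] at h4
    have : x.im ^ 2 ≠ 0 := pow_ne_zero _ him
    apply mul_right_cancel₀ this
    linear_combination -h4
  rw [him] at h
  ext
  · simpa using h
  · simpa using him

theorem QuadRing.intCast_dvd {n : ℤ} {x : QuadRing a b} :
    (n : QuadRing a b) ∣ x ↔ n ∣ x.re ∧ n ∣ x.im :=
  algebraMap_dvd_iff (r := n)

theorem QuadRing.intCast_dvd_intCast {n m : ℤ} :
    (n : QuadRing a b) ∣ (m : QuadRing a b) ↔ n ∣ m := by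
  rw [intCast_dvd]; simp

theorem QuadRing.isCoprime_norm {x : QuadRing a b} {n : ℤ} (h : IsCoprime x (n : QuadRing a b)) :
    IsCoprime (QuadraticAlgebra.norm x) n := by
  obtain ⟨u, v, h⟩ := h
  have h1 : QuadraticAlgebra.norm (u * x) = QuadraticAlgebra.norm (1 - v * (n : QuadRing a b)) :=
      congrArg QuadraticAlgebra.norm (by linear_combination h)
  rw [map_mul] at h1
  refine ⟨QuadraticAlgebra.norm u, trace v - n * QuadraticAlgebra.norm v, ?_⟩
  rw [h1, norm_apply (1 - v * (n : QuadRing a b)), norm_apply v, trace_def]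
  simp
  ring

theorem QuadRing.isCoprime_of_norm {x : QuadRing a b} {n : ℤ} (h : IsCoprime (QuadraticAlgebra.norm x) n) :
    IsCoprime x (n : QuadRing a b) := by
  have := h.map (Int.castRingHom (QuadRing a b))
  exact this.of_isCoprime_of_dvd_left (dvd_norm x)

theorem QuadRing.isCoprime_iff_norm {x : QuadRing a b} {n : ℤ} :
    IsCoprime x (n : QuadRing a b) ↔ IsCoprime (QuadraticAlgebra.norm x) n :=
  ⟨isCoprime_norm, isCoprime_of_norm⟩

theorem QuadRing.norm_dvd_norm {x y : QuadRing a b} (h : x ∣ y) : QuadraticAlgebra.norm x ∣ QuadraticAlgebra.norm y :=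
  map_dvd QuadraticAlgebra.norm h

theorem QuadRing.isDomain (hns : ¬ IsSquare (b ^ 2 + 4 * a)) : IsDomain (QuadRing a b) := by
  have : NoZeroDivisors (QuadRing a b) := ⟨fun {x y} h => by
    have := congrArg QuadraticAlgebra.norm h
    rw [map_mul, QuadraticAlgebra.norm_zero, mul_eq_zero, norm_eq_zero hns,
        norm_eq_zero hns] at this
    exact this⟩
  exact NoZeroDivisors.to_isDomain _

theorem QuadRing.finite_quotient (hns : ¬ IsSquare (b ^ 2 + 4 * a)) {m : QuadRing a b}
    (hm : m ≠ 0) : Finite (QuadRing a b ⧸ Ideal.span {m}) := by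
  have := isDomain hns
  apply Ideal.finiteQuotientOfFreeOfNeBot
  simpa using hm

/-- There are units of infinite order congruent to `1` modulo any nonzero element. -/
theorem QuadRing.exists_unit (hpos : 0 < b ^ 2 + 4 * a) (hns : ¬ IsSquare (b ^ 2 + 4 * a))
    {m : QuadRing a b} (hm : m ≠ 0) :
    ∃ u v : QuadRing a b, u * v = 1 ∧ m ∣ u - 1 ∧ u ^ 2 ≠ 1 := by
  obtain ⟨s, hs, hy⟩ := Pell.Solution₁.exists_pos_of_not_isSquare hpos hns
  have hx : 0 < s.x := by omega
  set f : Pell.Solution₁ (b ^ 2 + 4 * a) → QuadRing a b := fun s => ⟨s.x - s.y * b, 2 * s.y⟩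
  have hf : ∀ s t, f (s * t) = f s * f t := by
    intro s t
    ext <;> simp [f] <;> ring
  have hf1 : f 1 = 1 := by ext <;> simp [f]
  have hfin := finite_quotient hns hm
  obtain ⟨i, j, hne, hij⟩ := Finite.exists_ne_map_eq_of_infinite
    (fun n : ℕ => Ideal.Quotient.mk (Ideal.span {m}) (f (s ^ n)))
  wlog hlt : i < j generalizing i j
  · exact this j i hne.symm hij.symm (by omega)
  obtain ⟨k, rfl⟩ := Nat.exists_eq_add_of_lt hlt
  refine ⟨f (s ^ (k + 1)), f (s ^ (k + 1))⁻¹, ?_, ?_, ?_⟩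
  · rw [← hf, mul_inv_cancel, hf1]
  · rw [Ideal.Quotient.eq, Ideal.mem_span_singleton, ← dvd_neg] at hij
    have h1 : f (s ^ (i + k + 1)) - f (s ^ i) = f (s ^ i) * (f (s ^ (k + 1)) - 1) := by
      rw [add_assoc, pow_add, hf]; ring
    rw [neg_sub, h1] at hij
    have h2 : f ((s ^ i)⁻¹) * f (s ^ i) = 1 := by rw [← hf, inv_mul_cancel, hf1]
    have := dvd_mul_of_dvd_right hij (f ((s ^ i)⁻¹))
    rwa [← mul_assoc, h2, one_mul] at this
  · rw [sq, ← hf, ← pow_add]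
    intro h
    have h3 := congrArg QuadraticAlgebra.im h
    have h4 := Pell.Solution₁.y_pow_succ_pos hx hy (k + 1 + k)
    simp only [im_one] at h3
    have : 2 * (s ^ (k + 1 + (k + 1))).y = 0 := h3
    rw [← add_assoc] at this
    change 0 < (s ^ (k + 1 + k + 1)).y at h4
    omega

theorem QuadRing.exists_int_dvd_sub {x : QuadRing a b} (hx : IsCoprime x.re x.im)
    (y : QuadRing a b) : ∃ n : ℤ, x ∣ y - n := by
  obtain ⟨u, v, h⟩ := hx
  refine ⟨(y - y.im • (x * ⟨v - b * u, u⟩)).re, ⟨y.im • ⟨v - b * u, u⟩, ?_⟩⟩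
  have h1 : (x * ⟨v - b * u, u⟩ : QuadRing a b).im = 1 := by simp; linear_combination h
  rw [mul_smul_comm]
  ext
  · simp
  · simp at h1
    simp [h1]

/-- A nonunit of prime power norm, coprime to its conjugate. -/
structure QuadRing.Good (x : QuadRing a b) (l : ℕ) (k : ℕ) : Prop where
  prime : l.Prime
  odd : l ≠ 2
  pos : 0 < k
  norm_eq : QuadraticAlgebra.norm x = l ^ k ∨ QuadraticAlgebra.norm x = -l ^ k
  trace : ¬ (l : ℤ) ∣ trace x

theorem QuadRing.Good.dvd_pow {x : QuadRing a b} {l k : ℕ} (h : Good x l k) :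
    x ∣ (l : QuadRing a b) ^ k := by
  have := dvd_norm x
  rcases h.norm_eq with h | h <;> rw [h] at this <;> simpa using this

theorem QuadRing.Good.natAbs_norm {x : QuadRing a b} {l k : ℕ} (h : Good x l k) (j : ℕ) :
    (QuadraticAlgebra.norm (x ^ j)).natAbs = l ^ (k * j) := by
  rw [map_pow, Int.natAbs_pow, pow_mul]
  congr 1
  rcases h.norm_eq with h | h <;> rw [h] <;> simp

theorem QuadRing.Good.pow_dvd {x : QuadRing a b} {l k : ℕ} (h : Good x l k) (j : ℕ) :
    x ^ j ∣ (l : QuadRing a b) ^ (k * j) := by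
  rw [pow_mul]; exact pow_dvd_pow_of_dvd h.dvd_pow j

theorem QuadRing.Good.isCoprime {x y : QuadRing a b} {l k : ℕ} (h : Good x l k)
    (hy : IsCoprime y (l : QuadRing a b)) : IsCoprime y x :=
  (hy.pow_right (n := k)).of_isCoprime_of_dvd_right h.dvd_pow

theorem QuadRing.sq_eq (x : QuadRing a b) :
    x ^ 2 = ((QuadraticAlgebra.trace x : ℤ) : QuadRing a b) * x - ((QuadraticAlgebra.norm x : ℤ) : QuadRing a b) := by
  ext
  · simp [trace_def, norm_apply, sq]; ring
  · simp [trace_def, sq]; ring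

theorem QuadRing.Good.coprime_pow {x : QuadRing a b} {l k : ℕ} (h : Good x l k) (j : ℕ) :
    IsCoprime (x ^ j).re (x ^ j).im := by
  rcases j with _ | j
  · simpa using isCoprime_one_left
  have hl := Nat.prime_iff_prime_int.1 h.prime
  have key : ((l : ℤ) : QuadRing a b) ∣
      x ^ (j + 1) - (((QuadraticAlgebra.trace x) ^ j : ℤ) : QuadRing a b) * x := by
    induction j with
    | zero => simp
    | succ j ih =>
      have h1 : x ^ (j + 1 + 1) - (((QuadraticAlgebra.trace x) ^ (j + 1) : ℤ) : QuadRing a b) * x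
        = x * (x ^ (j + 1) - (((QuadraticAlgebra.trace x) ^ j : ℤ) : QuadRing a b) * x) -
          (((QuadraticAlgebra.trace x) ^ j : ℤ) : QuadRing a b) * ((QuadraticAlgebra.norm x : ℤ) : QuadRing a b) := by
        push_cast
        linear_combination (((QuadraticAlgebra.trace x : ℤ) : QuadRing a b) ^ j) * sq_eq x
      rw [h1]
      refine dvd_sub (dvd_mul_of_dvd_right ih _) (dvd_mul_of_dvd_right ?_ _)
      rw [intCast_dvd_intCast]
      rcases h.norm_eq with h2 | h2 <;> rw [h2]
      · exact dvd_pow_self _ h.pos.ne'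
      · exact (dvd_neg.2 (dvd_pow_self _ h.pos.ne'))
  rw [Int.isCoprime_iff_gcd_eq_one]
  by_contra hg
  obtain ⟨r, hr, hrg⟩ := Nat.exists_prime_and_dvd hg
  have h1 : (r : ℤ) ∣ (x ^ (j + 1)).re :=
      (Int.natCast_dvd_natCast.2 hrg).trans (Int.gcd_dvd_left ..)
  have h2 : (r : ℤ) ∣ (x ^ (j + 1)).im :=
      (Int.natCast_dvd_natCast.2 hrg).trans (Int.gcd_dvd_right ..)
  have h3 : ((r : ℤ) : QuadRing a b) ∣ x ^ (j + 1) := intCast_dvd.2 ⟨h1, h2⟩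
  have h4 := norm_dvd_norm h3
  rw [QuadraticAlgebra.norm_intCast] at h4
  have h5 : r ∣ l := by
    have : r ^ 2 ∣ l ^ (k * (j + 1)) := by
      rw [← h.natAbs_norm]
      simpa [Int.natAbs_pow] using Int.natAbs_dvd_natAbs.2 h4
    exact hr.dvd_of_dvd_pow ((dvd_pow_self r two_ne_zero).trans this)
  obtain rfl := (Nat.prime_dvd_prime_iff_eq hr h.prime).1 h5
  have h6 := (dvd_sub_right h3).1 key
  rw [intCast_dvd] at h6
  have h7 : (r : ℤ) ∣ QuadraticAlgebra.trace x ^ j → False := fun h8 =>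
    h.trace (hl.dvd_of_dvd_pow h8)
  simp only [re_mul, im_mul, re_intCast, im_intCast, mul_zero, zero_mul, add_zero] at h6
  have h8 := (hl.dvd_or_dvd h6.1).resolve_left h7
  have h9 : (r : ℤ) ∣ x.im := by
    rcases h6 with ⟨-, h6⟩
    exact (hl.dvd_or_dvd (by simpa using h6)).resolve_left h7
  apply h.trace
  rw [trace_def]
  exact dvd_add (dvd_mul_of_dvd_right h8 _) (dvd_mul_of_dvd_right h9 _)

end QuadRing

section IntPow

/-- Powers of an integer `V ≡ 1` modulo an odd prime `l` are dense near `1` in the `l`-adic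
topology. -/
theorem exists_pow_eq_one_add {l : ℕ} (hl : l.Prime) (hl2 : l ≠ 2) {V : ℤ} (hV : (l : ℤ) ∣ V - 1)
    {C : ℕ} (hC : ¬ (l : ℤ) ^ C ∣ V - 1) {J : ℕ} (hJ : C ≤ J) :
    ∃ (s : ℕ) (w : ℤ), V ^ s = 1 + l ^ J * w ∧ ¬ (l : ℤ) ∣ w := by
  have hodd := hl.odd_of_ne_two hl2
  have hlp := Nat.prime_iff_prime_int.1 hl
  have hfin : FiniteMultiplicity (l : ℤ) (V - 1) := by
    refine ⟨C, fun h => hC ((pow_dvd_pow _ (Nat.le_succ C)).trans h)⟩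
  have he : multiplicity (l : ℤ) (V - 1) < C := by
    by_contra! h
    exact hC (pow_dvd_of_le_multiplicity h)
  have hlV : ¬ (l : ℤ) ∣ V := fun h => hlp.not_dvd_one ((dvd_sub_right h).1 hV)
  have h1 := Int.emultiplicity_pow_sub_pow hl hodd (y := 1) (by simpa using hV) hlV
    (l ^ (J - multiplicity (l : ℤ) (V - 1)))
  rw [hl.emultiplicity_pow_self, hfin.emultiplicity_eq_multiplicity, one_pow] at h1
  rw [show ((multiplicity (l : ℤ) (V - 1) : ℕ∞)) +
    ((J - multiplicity (l : ℤ) (V - 1) : ℕ) : ℕ∞) = (J : ℕ) by norm_cast; omega] at h1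
  obtain ⟨⟨w, hw⟩, h2⟩ := emultiplicity_eq_coe.1 h1
  refine ⟨l ^ (J - multiplicity (l : ℤ) (V - 1)), w, by linear_combination hw, fun h => h2 ?_⟩
  rw [hw, pow_succ]
  exact mul_dvd_mul_left _ h

theorem exists_pow_mul_sub_dvd {l : ℕ} (hl : l.Prime) (hl2 : l ≠ 2) {V : ℤ}
    (hV : (l : ℤ) ∣ V - 1) {C : ℕ} (hC : ¬ (l : ℤ) ^ C ∣ V - 1) {n n' : ℤ}
    (hn : (l : ℤ) ^ C ∣ n' - n) (hln : ¬ (l : ℤ) ∣ n) (J : ℕ) :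
    ∃ s : ℕ, (l : ℤ) ^ J ∣ V ^ s * n' - n := by
  have hlp := Nat.prime_iff_prime_int.1 hl
  rcases le_total J C with h | h
  · exact ⟨0, by simpa using (pow_dvd_pow _ h).trans hn⟩
  induction J, h using Nat.le_induction with
  | base => exact ⟨0, by simpa using hn⟩
  | succ J hJ ih =>
    obtain ⟨s, y, hs⟩ := ih
    obtain ⟨e, w, he, hw⟩ := exists_pow_eq_one_add hl hl2 hV hC hJ
    have hJ0 : J ≠ 0 := by
      rintro rfl
      obtain rfl : C = 0 := by omega
      exact hC (by simp)
    have hlX : ¬ (l : ℤ) ∣ V ^ s * n' := fun h =>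
      hln ((dvd_sub_right h).1 (hs ▸ dvd_mul_of_dvd_left (dvd_pow_self _ hJ0) _))
    have hcop : IsCoprime (w * (V ^ s * n')) (l : ℤ) := by
      rw [isCoprime_comm]
      exact (hlp.irreducible.coprime_iff_not_dvd).2 (hlp.not_dvd_mul hw hlX)
    obtain ⟨u, v, huv⟩ := hcop
    obtain ⟨t, ht⟩ : ∃ t : ℕ, (l : ℤ) ∣ t + u * y := by
      refine ⟨((-(u * y)) % l).toNat, ?_⟩
      rw [Int.toNat_of_nonneg (Int.emod_nonneg _ (by exact_mod_cast hl.ne_zero))]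
      exact ⟨-(-(u * y) / l), by linear_combination Int.emod_add_mul_ediv (-(u*y)) l⟩
    obtain ⟨z, hz⟩ := ht
    have hexp : ∃ x : ℤ, (1 + (l : ℤ) ^ J * w) ^ t = 1 + t * (l ^ J * w) + l ^ (J + 1) * x := by
      clear hz
      induction t with
      | zero => exact ⟨0, by simp⟩
      | succ t ih =>
        obtain ⟨x, hx⟩ := ih
        obtain ⟨J, rfl⟩ : ∃ c, J = c + 1 := Nat.exists_eq_succ_of_ne_zero hJ0
        refine ⟨t * w * w * l ^ J + x + x * l ^ (J + 1) * w, ?_⟩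
        rw [pow_succ, hx]
        push_cast
        ring
    obtain ⟨x, hx⟩ := hexp
    refine ⟨e * t + s, ?_⟩
    rw [pow_add V, pow_mul, he, hx]
    refine ⟨z * w * V ^ s * n' + y * v + x * V ^ s * n', ?_⟩
    linear_combination hs - (l : ℤ) ^ J * y * huv + (l : ℤ) ^ J * w * V ^ s * n' * hz

end IntPow

section QuadRing

variable {a b : ℤ}

open QuadraticAlgebra

theorem QuadRing.Good.exists_unit_sq {x m : QuadRing a b} {l k : ℕ} (h : Good x l k)
    (hpos : 0 < b ^ 2 + 4 * a) (hns : ¬ IsSquare (b ^ 2 + 4 * a)) (hm0 : m ≠ 0)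
    (hm : IsCoprime m x) :
    ∃ C : ℕ, ∀ n n' : ℤ, m ∣ n - n' → (l : ℤ) ^ C ∣ n - n' → ¬ (l : ℤ) ∣ n →
      ∀ j : ℕ, ∃ u v : QuadRing a b, u * v = 1 ∧ m ∣ u - 1 ∧ m * x ^ j ∣ u ^ 2 * n' - n := by
  have := isDomain hns
  have hlp := Nat.prime_iff_prime_int.1 h.prime
  have hx0 : x ≠ 0 := by
    rintro rfl
    have := h.natAbs_norm 1
    simp at this
    exact h.prime.ne_zero (eq_zero_of_pow_eq_zero this.symm)
  obtain ⟨u, v, huv, hmu, hu1⟩ := exists_unit hpos hns (mul_ne_zero hm0 hx0)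
  have hmu1 := (dvd_mul_right m x).trans hmu
  have hxu1 := (dvd_mul_left x m).trans hmu
  have hD : QuadraticAlgebra.norm (u ^ 2 - 1) ≠ 0 := by
    rw [Ne, norm_eq_zero hns, sub_eq_zero]; exact hu1
  set i := (QuadraticAlgebra.norm (u ^ 2 - 1)).natAbs with hi
  refine ⟨k * i, fun n n' hmn hln hn j => ?_⟩
  obtain ⟨V, hV⟩ := exists_int_dvd_sub (h.coprime_pow (j + i + 1)) (u ^ 2)
  have hVx : ∀ c ≤ j + i + 1, x ^ c ∣ u ^ 2 - V := fun c hc => (pow_dvd_pow x hc).trans hV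
  have h1 : (l : ℤ) ∣ V - 1 := by
    have h2 : x ∣ ((V - 1 : ℤ) : QuadRing a b) := by
      have h3 : ((V - 1 : ℤ) : QuadRing a b) = (u - 1) * (u + 1) - (u ^ 2 - V) := by
        push_cast; ring
      rw [h3]
      exact dvd_sub (dvd_mul_of_dvd_left hxu1 _) (by simpa using hVx 1 (by omega))
    have h4 := Int.natAbs_dvd_natAbs.2 (norm_dvd_norm h2)
    rw [QuadraticAlgebra.norm_intCast, ← pow_one x, h.natAbs_norm] at h4
    have h5 : (l : ℤ) ∣ (V - 1) ^ 2 := by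
      rw [← Int.natCast_dvd] at h4
      refine dvd_trans ?_ h4
      push_cast
      exact dvd_pow_self _ (by simpa using h.pos.ne')
    exact hlp.dvd_of_dvd_pow h5
  have h2 : ¬ (l : ℤ) ^ (k * i) ∣ V - 1 := by
    intro h3
    have h4 : x ^ i ∣ u ^ 2 - 1 := by
      have h5 : u ^ 2 - 1 = (u ^ 2 - V) + ((V - 1 : ℤ) : QuadRing a b) := by push_cast; ring
      rw [h5]
      refine dvd_add (hVx i (by omega)) ((h.pow_dvd i).trans ?_)
      have := (intCast_dvd_intCast (a := a) (b := b)).2 h3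
      exact_mod_cast this
    have h6 := Nat.le_of_dvd (Int.natAbs_pos.2 hD) (Int.natAbs_dvd_natAbs.2 (norm_dvd_norm h4))
    rw [h.natAbs_norm, ← hi] at h6
    have h7 : i < l ^ i := Nat.lt_pow_self h.prime.one_lt
    have h8 : l ^ i ≤ l ^ (k * i) :=
      Nat.pow_le_pow_right h.prime.pos (Nat.le_mul_of_pos_left _ h.pos)
    omega
  obtain ⟨s, hs⟩ := exists_pow_mul_sub_dvd h.prime h.odd h1 h2 ((dvd_sub_comm).1 hln) hn
    (k * (j + i + 1))
  refine ⟨u ^ s, v ^ s, by rw [← mul_pow, huv, one_pow], ?_, ?_⟩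
  · exact hmu1.trans (sub_one_dvd_pow_sub_one u s)
  · apply (hm.pow_right (n := j)).mul_dvd
    · have h3 : (u ^ s) ^ 2 * n' - n = ((u ^ s) ^ 2 - 1) * n' - ((n : QuadRing a b) - n') := by ring
      rw [h3]
      refine dvd_sub (dvd_mul_of_dvd_left (hmu1.trans ?_) _) hmn
      rw [← pow_mul]
      exact sub_one_dvd_pow_sub_one u _
    · have h3 : (u ^ s) ^ 2 * n' - n = ((u ^ 2) ^ s - (V : QuadRing a b) ^ s) * n' +
          ((V ^ s * n' - n : ℤ) : QuadRing a b) := by push_cast; ring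
      rw [h3]
      refine dvd_add (dvd_mul_of_dvd_left ((hVx j (by omega)).trans (sub_dvd_pow_sub_pow _ _ s)) _) ?_
      refine (pow_dvd_pow x (show j ≤ j + i + 1 by omega)).trans ((h.pow_dvd _).trans ?_)
      have := (intCast_dvd_intCast (a := a) (b := b)).2 hs
      exact_mod_cast this

/-- The ring homomorphism to `S` sending `ω` to a root `r` of its minimal polynomial. -/
def QuadRing.toRing {S : Type*} [CommRing S] (r : S) (hr : r * r = a + b * r) :
    QuadRing a b →+* S where
  toFun x := x.re + x.im * r
  map_one' := by simp
  map_mul' x y := by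
    simp only [re_mul, im_mul]; push_cast; linear_combination -(x.im * y.im : S) * hr
  map_zero' := by simp
  map_add' x y := by simp only [re_add, im_add]; push_cast; ring

theorem QuadRing.toRing_apply {S : Type*} [CommRing S] (r : S) (hr : r * r = a + b * r)
    (x : QuadRing a b) : toRing r hr x = x.re + x.im * r := rfl

end QuadRing

section Jacobi

open jacobiSym NumberTheorySymbols

theorem jacobiSym_eq_of_dvd_add {B n p : ℕ} (hB : 0 < B) (hn : n % 4 = 1)
    (h : 4 * B ∣ n + p) : J(B | p) = J(B | n) := by
  obtain ⟨k, hk⟩ := h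
  have hp : p % 4 = 3 := by
    have : (n + p) % 4 = 0 := by rw [hk, mul_assoc]; exact Nat.mul_mod_right 4 _
    omega
  rw [jacobiSym.mod_right' B (b := p) (Nat.odd_iff.2 (by omega)),
    jacobiSym.mod_right' B (b := n) (Nat.odd_iff.2 (by omega))]
  have hn0 : n % (4 * B) % 4 = 1 := by rw [Nat.mod_mul_right_mod, hn]
  have hp0 : p % (4 * B) % 4 = 3 := by rw [Nat.mod_mul_right_mod, hp]
  have hsum : n % (4 * B) + p % (4 * B) = 4 * B := by
    have h1 : (n % (4 * B) + p % (4 * B)) % (4 * B) = 0 := by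
      rw [← Nat.add_mod, hk]; exact Nat.mul_mod_right _ _
    have h2 := Nat.mod_lt n (show 0 < 4 * B by omega)
    have h3 := Nat.mod_lt p (show 0 < 4 * B by omega)
    obtain ⟨c, hc⟩ := Nat.dvd_of_mod_eq_zero h1
    have : c = 1 := by
      have : c < 2 := by
        by_contra! h; nlinarith
      have : c ≠ 0 := by rintro rfl; omega
      omega
    rw [hc, this, mul_one]
  generalize n % (4 * B) = m at *
  generalize p % (4 * B) = r at *
  have hm : Odd m := Nat.odd_iff.2 (by omega)
  have hr : Odd r := Nat.odd_iff.2 (by omega)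
  have h4 : ∀ c, Odd c → J(B | c) = J((4 * B : ℕ) | c) := fun c hc => by
    push_cast
    rw [jacobiSym.mul_left, jacobiSym.at_four hc, one_mul]
  rw [h4 r hr, h4 m hm, ← hsum]
  have e1 : J((m + r : ℕ) | r) = J(m | r) := by
    apply jacobiSym.mod_left'; push_cast; simp
  have e2 : J((m + r : ℕ) | m) = J(r | m) := by
    apply jacobiSym.mod_left'; push_cast; simp
  rw [e1, e2]
  exact jacobiSym.quadratic_reciprocity_one_mod_four hn0 hr

theorem jacobiSym_eq_one_of_dvd_add {B : ℤ} {n p : ℕ} (hn : n % 4 = 1)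
    (h : (4 * B.natAbs) ∣ n + p)
    (hs : (0 < B ∧ J(B | n) = 1) ∨ (B < 0 ∧ J(B | n) = -1)) : J(B | p) = 1 := by
  have hp : p % 4 = 3 := by
    obtain ⟨k, hk⟩ := h
    have : (n + p) % 4 = 0 := by rw [hk, mul_assoc]; exact Nat.mul_mod_right 4 _
    omega
  have hB : 0 < B.natAbs := by omega
  have key := jacobiSym_eq_of_dvd_add hB hn h
  rcases hs with ⟨h1, h2⟩ | ⟨h1, h2⟩
  · have : ((B.natAbs : ℕ) : ℤ) = B := by omega
    rw [this] at key
    rw [key, h2]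
  · have : ((B.natAbs : ℕ) : ℤ) = -B := by omega
    rw [this, jacobiSym.neg _ (Nat.odd_iff.2 (by omega)),
        jacobiSym.neg _ (Nat.odd_iff.2 (by omega)),
      ZMod.χ₄_nat_one_mod_four hn, ZMod.χ₄_nat_three_mod_four hp, h2] at key
    linarith

end Jacobi

section QuadRing

variable {a b : ℤ}

open QuadraticAlgebra

/-- The square root of the discriminant. -/
def QuadRing.delta (a b : ℤ) : QuadRing a b := ⟨-b, 2⟩

theorem QuadRing.delta_mul_self : delta a b * delta a b = ((b ^ 2 + 4 * a : ℤ) : QuadRing a b) := by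
  ext <;> simp [delta, sq] <;> ring

theorem QuadRing.exists_split {p q : ℕ} [Fact p.Prime] (hpos : 0 < b ^ 2 + 4 * a)
    (hq : 4 * (b ^ 2 + 4 * a) ∣ (q : ℤ)) (hp : q ∣ p + 1) :
    ∃ f g : QuadRing a b →+* ZMod p, (∀ x, f x = 0 → g x = 0 → (p : QuadRing a b) ∣ x) ∧
      (∀ s t, ∃ X Y : ZMod p, ∀ x y : ℤ, (x : ZMod p) = X → (y : ZMod p) = Y →
        f (x + y * delta a b) = s ∧ g (x + y * delta a b) = t) ∧
      (∀ x, f x * g x = (QuadraticAlgebra.norm x : ℤ)) := by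
  obtain ⟨D, hD⟩ := Int.eq_ofNat_of_zero_le hpos.le
  have h4D : 4 * D ∣ 1 + p := by
    rw [hD] at hq
    have : 4 * D ∣ q := by exact_mod_cast hq
    rw [add_comm]; exact this.trans hp
  have hJ := jacobiSym_eq_of_dvd_add (by omega) (by norm_num) h4D
  rw [jacobiSym.one_right] at hJ
  obtain ⟨ρ, hρ⟩ := ZMod.isSquare_of_jacobiSym_eq_one hJ
  have hp2 : p % 4 = 3 := by
    obtain ⟨k, hk⟩ := h4D
    have : (1 + p) % 4 = 0 := by rw [hk, mul_assoc]; exact Nat.mul_mod_right 4 _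
    omega
  have h2 : (2 : ZMod p) ≠ 0 := by
    intro h
    have : ((2 : ℕ) : ZMod p) = 0 := by exact_mod_cast h
    rw [ZMod.natCast_eq_zero_iff] at this
    have := Nat.le_of_dvd (by norm_num) this
    omega
  have hρ2 : ρ ^ 2 = (b : ZMod p) ^ 2 + 4 * a := by
    rw [sq, ← hρ]
    have := congrArg (Int.cast : ℤ → ZMod p) hD
    push_cast at this ⊢
    exact this.symm
  have hρ0 : ρ ≠ 0 := by
    rintro rfl
    rw [mul_zero] at hρ
    have h5 : ((D : ℕ) : ZMod p) = 0 := by exact_mod_cast hρ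
    rw [ZMod.natCast_eq_zero_iff] at h5
    have h6 : p ∣ 1 := (Nat.dvd_add_right (dvd_refl p)).1
      (by rw [add_comm]; exact (h5.trans (dvd_mul_left D 4)).trans h4D)
    exact (Fact.out : p.Prime).one_lt.ne' (Nat.dvd_one.1 h6)
  have hr1 : ((b : ZMod p) + ρ) / 2 * (((b : ZMod p) + ρ) / 2) =
      a + b * (((b : ZMod p) + ρ) / 2) := by
    field_simp
    linear_combination hρ2
  have hr2 : ((b : ZMod p) - ρ) / 2 * (((b : ZMod p) - ρ) / 2) =
      a + b * (((b : ZMod p) - ρ) / 2) := by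
    field_simp
    linear_combination hρ2
  refine ⟨toRing _ hr1, toRing _ hr2, ?_, ?_, ?_⟩
  · intro x hx hy
    rw [toRing_apply] at hx hy
    have him : (x.im : ZMod p) = 0 := by
      have h7 : (x.im : ZMod p) * ρ = 0 := by
        field_simp at hx hy
        apply mul_left_cancel₀ h2
        linear_combination hx - hy
      exact (mul_eq_zero.1 h7).resolve_right hρ0
    have hre : (x.re : ZMod p) = 0 := by simpa [him] using hx
    rw [ZMod.intCast_zmod_eq_zero_iff_dvd] at him hre
    have := (intCast_dvd (n := p) (x := x)).2 ⟨hre, him⟩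
    exact_mod_cast this
  · intro s t
    refine ⟨(s + t) / 2, (s - t) / (2 * ρ), fun x y hx hy => ?_⟩
    simp only [map_add, map_mul, map_intCast, toRing_apply, delta, hx, hy]
    push_cast
    constructor <;> field_simp <;> ring
  · intro x
    rw [toRing_apply, toRing_apply, norm_apply]
    push_cast
    field_simp
    linear_combination (-x.im ^ 2 : ZMod p) * hρ2

theorem QuadRing.dvd_pow_sub_one {p q : ℕ} [Fact p.Prime] (hpos : 0 < b ^ 2 + 4 * a)
    (hq : 4 * (b ^ 2 + 4 * a) ∣ (q : ℤ)) (hp : q ∣ p + 1) {x : QuadRing a b}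
    (hx : IsCoprime x (p : QuadRing a b)) (k : ℕ) :
    (p : QuadRing a b) ∣ x ^ ((p - 1) * k) - 1 := by
  obtain ⟨f, g, h0, -, -⟩ := exists_split (a := a) (b := b) hpos hq hp
  have key : ∀ f : QuadRing a b →+* ZMod p, f (x ^ ((p - 1) * k) - 1) = 0 := by
    intro f
    have h1 : f x ≠ 0 := by
      have := hx.map f
      rw [map_natCast, ZMod.natCast_self, isCoprime_zero_right] at this
      exact this.ne_zero
    rw [map_sub, map_pow, map_one, pow_mul, ZMod.pow_card_sub_one_eq_one h1, one_pow, sub_self]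
  exact h0 _ (key f) (key g)

end QuadRing

section QuadRing

variable {a b : ℤ}

open QuadraticAlgebra

theorem QuadRing.isCoprime_natCast {x : QuadRing a b} {n : ℕ} :
    IsCoprime x (n : QuadRing a b) ↔ IsCoprime (QuadraticAlgebra.norm x) (n : ℤ) := by
  rw [← isCoprime_iff_norm, Int.cast_natCast]

theorem QuadRing.natCast_dvd_natCast {m n : ℕ} :
    (m : QuadRing a b) ∣ (n : QuadRing a b) ↔ m ∣ n := by
  have := intCast_dvd_intCast (a := a) (b := b) (n := m) (m := n)
  rwa [Int.natCast_dvd_natCast, Int.cast_natCast, Int.cast_natCast] at this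

theorem QuadRing.dvd_neg_sub_one {q p : ℕ} (h : q ∣ p + 1) :
    (q : QuadRing a b) ∣ -(p : QuadRing a b) - 1 := by
  have := (natCast_dvd_natCast (a := a) (b := b)).2 h
  rw [← dvd_neg]
  convert this using 1
  push_cast; ring

/-- An auxiliary prime for comparing symbols. -/
theorem exists_prime_aux {p q N l C : ℕ} (hp : p.Prime) (hqp : q ∣ p + 1) (h4 : 4 ∣ q)
    (hN0 : N ≠ 0) (hl : l.Prime) (hlp : l.Coprime (q * p * (p - 1))) (hN : N.Coprime (p * (p - 1))) :
    ∃ p' s k : ℕ, p'.Prime ∧ p' ≡ p [MOD q * N * l ^ C] ∧ l < p' ∧ q ∣ p' + 1 ∧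
      (p - 1) * s = 2 + (p' - 1) * k := by
  have h4p : 4 ∣ p + 1 := h4.trans hqp
  have hq0 : q ≠ 0 := by rintro rfl; simp at hqp
  obtain ⟨W, hW⟩ : ∃ W, p - 1 = 2 * W := ⟨(p - 1) / 2, by omega⟩
  have hp2 := hp.two_le
  have hWodd : W % 2 = 1 := by omega
  have hlq : l.Coprime q := hlp.coprime_dvd_right ⟨p * (p - 1), by ring⟩
  have hlp' : l.Coprime p := hlp.coprime_dvd_right ⟨q * (p - 1), by ring⟩
  have hlW : l.Coprime W := hlp.coprime_dvd_right ⟨q * p * 2, by rw [hW]; ring⟩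
  have hNp : N.Coprime p := hN.coprime_dvd_right ⟨(p - 1), by ring⟩
  have hNW : N.Coprime W := hN.coprime_dvd_right ⟨p * 2, by rw [hW]; ring⟩
  have hqW : q.Coprime W := by
    apply Nat.Coprime.of_dvd_left hqp
    have : p + 1 = 2 + W * 2 := by omega
    rw [this, Nat.coprime_add_mul_left_left, Nat.coprime_two_left, Nat.odd_iff]
    exact hWodd
  have hqp' : q.Coprime p := by
    apply Nat.Coprime.of_dvd_left hqp
    simp
  set M := q * N * l ^ C with hM
  have hMW : M.Coprime W := (hqW.mul_left hNW).mul_left (hlW.pow_left C)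
  have hMp : M.Coprime p := (hqp'.mul_left hNp).mul_left (hlp'.pow_left C)
  obtain ⟨c, hc1, hc2⟩ := Nat.chineseRemainder hMW p (W - 1)
  have hM0 : M ≠ 0 := by positivity [hl.pos, Nat.pos_of_ne_zero hq0, Nat.pos_of_ne_zero hN0]
  have hcop : c.Coprime (M * W) := by
    apply Nat.Coprime.mul_right
    · rw [Nat.Coprime, hc1.gcd_eq]; exact hMp.symm
    · rw [Nat.Coprime, hc2.gcd_eq]
      have : W = (W - 1) + 1 := by omega
      nth_rw 2 [this]
      simp
  obtain ⟨p', hp'l, hp', hp'c⟩ := Nat.forall_exists_prime_gt_and_modEq (l + 2)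
    (Nat.mul_ne_zero hM0 (by omega : W ≠ 0)) hcop
  have h1 : p' ≡ p [MOD M] := (hp'c.of_mul_right W).trans hc1
  have h2 : p' ≡ W - 1 [MOD W] := (hp'c.of_mul_left M).trans hc2
  have hW' : W ∣ p' + 1 := by
    have := h2.add_right 1
    rw [show W - 1 + 1 = W by omega] at this
    exact (Nat.modEq_zero_iff_dvd).1 (this.trans (by simp [Nat.ModEq]))
  have hcop2 : W.Coprime (p' - 1) := by
    have h3 : W.gcd (p' - 1) ∣ 2 := by
      have h4 : W.gcd (p' - 1) ∣ p' + 1 := (Nat.gcd_dvd_left _ _).trans hW'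
      rw [show p' + 1 = (p' - 1) + 2 by omega] at h4
      exact (Nat.dvd_add_right (Nat.gcd_dvd_right _ _)).1 h4
    rcases (Nat.dvd_prime Nat.prime_two).1 h3 with h4 | h4
    · exact h4
    · have := Nat.gcd_dvd_left W (p' - 1)
      rw [h4] at this
      omega
  obtain ⟨s, -, hs⟩ := Nat.exists_mul_mod_eq_one_of_coprime hcop2 (by omega)
  refine ⟨p', s, 2 * (W * s / (p' - 1)), hp', h1, by omega, ?_, ?_⟩
  · have h3 : p' ≡ p [MOD q] := (h1.of_mul_right _).of_mul_right _
    exact (Nat.modEq_zero_iff_dvd).1 ((h3.add_right 1).trans ((Nat.modEq_zero_iff_dvd).2 hqp))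
  · have := Nat.mod_add_div (W * s) (p' - 1)
    rw [hs] at this
    rw [hW]
    generalize W * s / (p' - 1) = D at this ⊢
    rw [mul_assoc, ← this]
    ring

variable {A : Type*} [CommGroup A] {φ : SpecialLinearGroup (Fin 2) (QuadRing a b) →* A} {q : ℕ}

theorem QuadRing.relSym_good (hpos : 0 < b ^ 2 + 4 * a) (hns : ¬ IsSquare (b ^ 2 + 4 * a))
    (hq4 : 4 * (b ^ 2 + 4 * a) ∣ (q : ℤ))
    (hq : ∀ x, φ (upperElem ((q : QuadRing a b) * x)) = 1)
    {p : ℕ} (hp : p.Prime) (hqp : q ∣ p + 1) {x : QuadRing a b} {l k : ℕ} (h : Good x l k)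
    (hl : l.Coprime (q * p * (p - 1))) {β : QuadRing a b} (hβ : IsCoprime β (p : QuadRing a b)) :
    relSym φ (q : QuadRing a b) (-p) (β * x ^ 2) = relSym φ (q : QuadRing a b) (-p) β := by
  have := isDomain hns
  have := Fact.mk hp
  have hp2 := hp.two_le
  have hqa := dvd_neg_sub_one (a := a) (b := b) hqp
  have hl2 := h.prime.two_le
  have hN0 : ((l * (p - 1) : ℕ) : QuadRing a b) ≠ 0 := by
    rw [Nat.cast_ne_zero]
    exact Nat.mul_ne_zero h.prime.ne_zero (by omega)
  have := finite_quotient hns hN0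
  have hxp : IsCoprime x (p : QuadRing a b) := by
    have h1 : Nat.Coprime p l := (hl.coprime_dvd_right ⟨q * (p - 1), by ring⟩).symm
    have h2 := (Nat.isCoprime_iff_coprime.2 h1).map (Int.castRingHom (QuadRing a b))
    simp only [eq_intCast, Int.cast_natCast] at h2
    exact (h.isCoprime h2).symm
  wlog hβ1 : IsCoprime β ((l * (p - 1) : ℕ) : QuadRing a b) generalizing β
  · obtain ⟨t, ht⟩ := exists_isCoprime_add_mul (a := (p : QuadRing a b)) (b := β)
      (N := ((l * (p - 1) : ℕ) : QuadRing a b))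
      (by obtain ⟨u, v, huv⟩ := hβ; exact ⟨v, u, 0, by linear_combination huv⟩)
    have h1 : IsCoprime (β + t * p) (p : QuadRing a b) := IsCoprime.add_mul_right_left hβ t
    have h2 := this h1 ht
    rw [show β + t * p = β + -(p : QuadRing a b) * -t by ring,
      show (β + -(p : QuadRing a b) * -t) * x ^ 2 =
          β * x ^ 2 + -(p : QuadRing a b) * -(t * x ^ 2) by
        ring, relSym_add_right hq hqa, relSym_add_right hq hqa] at h2
    · exact h2
    · exact (hβ.symm).neg_left
    · exact (hβ.symm.mul_right hxp.symm.pow_right).neg_left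
  have hβN := isCoprime_natCast.1 hβ1
  have hβp := isCoprime_natCast.1 hβ
  have hβ0 : QuadraticAlgebra.norm β ≠ 0 := by
    intro h0
    rw [h0, isCoprime_zero_left, Int.isUnit_iff] at hβp
    omega
  have hq0 : q ≠ 0 := by rintro rfl; simp at hqp
  have hm0 : (q : QuadRing a b) * β ≠ 0 :=
    mul_ne_zero (by exact_mod_cast hq0) ((norm_eq_zero hns).not.1 hβ0)
  have hmx : IsCoprime ((q : QuadRing a b) * β) x := by
    apply h.isCoprime
    apply IsCoprime.mul_left
    · have h1 : Nat.Coprime q l := (hl.coprime_dvd_right ⟨p * (p - 1), by ring⟩).symm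
      have h2 := (Nat.isCoprime_iff_coprime.2 h1).map (Int.castRingHom (QuadRing a b))
      simpa only [eq_intCast, Int.cast_natCast] using h2
    · push_cast at hβ1
      exact hβ1.of_mul_right_left
  obtain ⟨C, hC⟩ := h.exists_unit_sq hpos hns hm0 hmx
  obtain ⟨p', s, k', hp', hmod, hlp', hqp', hs⟩ := exists_prime_aux (C := C)
    (N := (QuadraticAlgebra.norm β).natAbs) hp hqp
    (by have := (dvd_mul_right 4 (b ^ 2 + 4 * a)).trans hq4; exact_mod_cast this)
    (by simpa using hβ0) h.prime hl
    (by
      rw [Int.isCoprime_iff_nat_coprime, Int.natAbs_natCast] at hβp hβN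
      exact hβp.mul_right (hβN.coprime_dvd_right (dvd_mul_left _ _)))
  have := Fact.mk hp'
  have hqa' := dvd_neg_sub_one (a := a) (b := b) hqp'
  have hxp' : IsCoprime x (p' : QuadRing a b) := by
    have h1 : Nat.Coprime p' l := (Nat.coprime_primes hp' h.prime).2 hlp'.ne'
    have h2 := (Nat.isCoprime_iff_coprime.2 h1).map (Int.castRingHom (QuadRing a b))
    simp only [eq_intCast, Int.cast_natCast] at h2
    exact (h.isCoprime h2).symm
  have hβp' : IsCoprime β (p' : QuadRing a b) := by
    rw [isCoprime_natCast, Int.isCoprime_iff_nat_coprime, Int.natAbs_natCast] at hβ ⊢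
    have h1 : p' ≡ p [MOD (QuadraticAlgebra.norm β).natAbs] := (hmod.of_mul_right _).of_mul_left _
    rw [Nat.coprime_comm] at hβ ⊢
    rw [Nat.Coprime, h1.gcd_eq]
    exact hβ
  have hcop : ∀ i, IsCoprime (-(p : QuadRing a b)) (β * x ^ i) := fun i =>
    (hβ.symm.mul_right hxp.symm.pow_right).neg_left
  have hcop' : ∀ i, IsCoprime (-(p' : QuadRing a b)) (β * x ^ i) := fun i =>
    (hβp'.symm.mul_right hxp'.symm.pow_right).neg_left
  have hZ : ((q * (QuadraticAlgebra.norm β).natAbs * l ^ C : ℕ) : ℤ) ∣ (-p : ℤ) - (-p') := by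
    rw [show (-p : ℤ) - (-p') = -(p - p') by ring, dvd_neg]
    exact hmod.dvd
  have hswap : ∀ i, relSym φ (q : QuadRing a b) (-p) (β * x ^ i) =
      relSym φ (q : QuadRing a b) (-p') (β * x ^ i) := by
    intro i
    obtain ⟨u, v, huv, hmu, t, ht⟩ := hC (-p) (-p') (by
        have h1 := (intCast_dvd_intCast (a := a) (b := b)).2 hZ
        push_cast at h1 ⊢
        refine dvd_trans ?_ h1
        refine dvd_mul_of_dvd_left (mul_dvd_mul_left _ ?_) _
        have h2 := dvd_norm β
        rcases abs_choice (QuadraticAlgebra.norm β) with h3 | h3 <;> rw [h3]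
        · exact h2
        · rwa [Int.cast_neg, dvd_neg])
      (by
        refine dvd_trans ?_ hZ
        push_cast
        exact dvd_mul_left _ _)
      (by
        rw [dvd_neg, Int.natCast_dvd_natCast]
        intro h1
        have h2 : Nat.Coprime l p := hl.coprime_dvd_right ⟨q * (p - 1), by ring⟩
        exact h.prime.one_lt.ne' (Nat.Coprime.eq_one_of_dvd h2 h1)) i
    have hqu : (q : QuadRing a b) ∣ u ^ 2 - 1 :=
      ((dvd_mul_right _ _).trans hmu).trans (sub_one_dvd_pow_sub_one u 2)
    rw [← relSym_unit_sq_mul_left hq hqa' (hcop' i) huv hqu,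
      ← relSym_add_left hq hqa (hcop i) t]
    congr 1
    push_cast at ht
    linear_combination -ht
  obtain ⟨y, hy⟩ := dvd_pow_sub_one hpos hq4 hqp hxp s
  obtain ⟨y', hy'⟩ := dvd_pow_sub_one hpos hq4 hqp' hxp' k'
  have e1 : relSym φ (q : QuadRing a b) (-p) (β * x ^ ((p - 1) * s)) =
      relSym φ (q : QuadRing a b) (-p) β := by
    rw [show β * x ^ ((p - 1) * s) = β + -(p : QuadRing a b) * -(β * y) by
      linear_combination β * hy, relSym_add_right hq hqa hβ.symm.neg_left]
  have e2 : relSym φ (q : QuadRing a b) (-p') (β * x ^ ((p - 1) * s)) =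
      relSym φ (q : QuadRing a b) (-p') (β * x ^ 2) := by
    rw [hs, show β * x ^ (2 + (p' - 1) * k') =
      β * x ^ 2 + -(p' : QuadRing a b) * -(β * x ^ 2 * y') by
        rw [pow_add]; linear_combination β * x ^ 2 * hy', relSym_add_right hq hqa' (hcop' 2)]
  rw [← e1, hswap ((p - 1) * s), e2, hswap 2]

end QuadRing

section QuadRing

variable {a b : ℤ}

open QuadraticAlgebra

theorem Ideal.IsPrime.exists_prime_natCast_mem {R : Type*} [CommRing R] {P : Ideal R}
    (hP : P.IsPrime) {n : ℕ} (hn : n ≠ 0) (h : (n : R) ∈ P) :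
    ∃ l : ℕ, l.Prime ∧ l ∣ n ∧ (l : R) ∈ P := by
  induction n using induction_on_primes with
  | zero => exact absurd rfl hn
  | one => exact absurd ((Ideal.eq_top_iff_one _).2 (by simpa using h)) hP.ne_top
  | prime_mul l n hl ih =>
    rw [Nat.cast_mul] at h
    rcases hP.mem_or_mem h with h | h
    · exact ⟨l, hl, dvd_mul_right _ _, h⟩
    · obtain ⟨r, h1, h2, h3⟩ := ih (right_ne_zero_of_mul hn) h
      exact ⟨r, h1, h2.mul_left _, h3⟩

theorem QuadRing.star_add_mul_delta (X Y : ℤ) :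
    star ((X : QuadRing a b) + (Y : QuadRing a b) * delta a b) = X - Y * delta a b := by
  ext <;> simp [delta]; ring

theorem QuadRing.norm_add_mul_delta (X Y : ℤ) :
    QuadraticAlgebra.norm ((X : QuadRing a b) + (Y : QuadRing a b) * delta a b) =
        X ^ 2 - (b ^ 2 + 4 * a) * Y ^ 2 := by
  rw [norm_apply]; simp [delta]; ring

theorem QuadRing.good_of_prime {q h : ℕ} (hh : 0 < h) (hq4 : 4 * (b ^ 2 + 4 * a) ∣ (q : ℤ))
    {P : Ideal (QuadRing a b)} (hP : P.IsPrime) {x : QuadRing a b} (hx : P ^ h = Ideal.span {x})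
    {l : ℕ} (hl : l.Prime) (hlP : (l : QuadRing a b) ∈ P) (hlq : l.Coprime q) {X Y : ℤ}
    (hXY : IsCoprime X Y) (hz : (X : QuadRing a b) + (Y : QuadRing a b) * delta a b ∈ P) :
    ∃ k, Good x l k := by
  have hxP : x ∈ P := Ideal.pow_le_self hh.ne' (hx ▸ Ideal.mem_span_singleton_self x)
  have hxl : x ∣ (l : QuadRing a b) ^ h := by
    rw [← Ideal.mem_span_singleton, ← hx]; exact Ideal.pow_mem_pow hlP h
  have hN : (QuadraticAlgebra.norm x).natAbs ∣ l ^ (2 * h) := by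
    have h1 := Int.natAbs_dvd_natAbs.2 (norm_dvd_norm hxl)
    rwa [map_pow, QuadraticAlgebra.norm_natCast, ← pow_mul, Int.natAbs_pow,
        Int.natAbs_natCast] at h1
  obtain ⟨k, -, hk⟩ := (Nat.dvd_prime_pow hl).1 hN
  have key : ∀ n : ℕ, (n : QuadRing a b) ∈ P → n.Coprime l → False := by
    intro n hn hnl
    have h1 := (Nat.isCoprime_iff_coprime.2 hnl).map (Int.castRingHom (QuadRing a b))
    simp only [eq_intCast, Int.cast_natCast] at h1
    obtain ⟨u, v, huv⟩ := h1
    exact hP.ne_top ((Ideal.eq_top_iff_one _).2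
      (huv ▸ P.add_mem (P.mul_mem_left u hn) (P.mul_mem_left v hlP)))
  have hl2 : l ≠ 2 := by
    rintro rfl
    have : (4 : ℤ) ∣ q := (dvd_mul_right _ _).trans hq4
    have : 4 ∣ q := by exact_mod_cast this
    rw [Nat.coprime_two_left, Nat.odd_iff] at hlq
    omega
  refine ⟨k, hl, hl2, Nat.pos_of_ne_zero ?_, ?_, ?_⟩
  · rintro rfl
    rw [pow_zero, ← Int.isUnit_iff_natAbs_eq] at hk
    exact hP.ne_top (Ideal.eq_top_of_isUnit_mem _ hxP (isUnit_iff_norm_isUnit.2 hk))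
  · rcases Int.natAbs_eq (QuadraticAlgebra.norm x) with h1 | h1 <;> rw [hk] at h1
    · left; rw [h1]; push_cast; rfl
    · right; rw [h1]; push_cast; rfl
  · intro htr
    have htr' : ((QuadraticAlgebra.trace x : ℤ) : QuadRing a b) ∈ P := by
      obtain ⟨c, hc⟩ := htr
      rw [hc, Int.cast_mul, Int.cast_natCast]
      exact P.mul_mem_right _ hlP
    have hsx : star x ∈ P := by
      have h1 : star x = ((QuadraticAlgebra.trace x : ℤ) : QuadRing a b) - x := by
        ext <;> simp [trace_def]; ring
      rw [h1]
      exact P.sub_mem htr' hxP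
    have hstar : ∀ y ∈ P, star y ∈ P := by
      intro y hy
      have h1 := Ideal.pow_mem_pow hy h
      rw [hx, Ideal.mem_span_singleton] at h1
      obtain ⟨c, hc⟩ := h1
      have h2 := congrArg star hc
      rw [star_pow, star_mul] at h2
      exact hP.mem_of_pow_mem h (h2 ▸ P.mul_mem_left _ hsx)
    have hz' := hstar _ hz
    rw [star_add_mul_delta] at hz'
    have h1 : (2 * X : QuadRing a b) ∈ P := by
      convert P.add_mem hz hz' using 1; ring
    have h2 : (2 * Y * (b ^ 2 + 4 * a : ℤ) : QuadRing a b) ∈ P := by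
      rw [← delta_mul_self]
      convert P.mul_mem_left (delta a b) (P.sub_mem hz hz') using 1; ring
    obtain ⟨u, v, huv⟩ := hXY
    have h3 : ((2 * (b ^ 2 + 4 * a) : ℤ) : QuadRing a b) ∈ P := by
      have h4 := congrArg (Int.cast : ℤ → QuadRing a b) huv
      push_cast at h4
      convert P.add_mem (P.mul_mem_left (u * (b ^ 2 + 4 * a)) h1) (P.mul_mem_left (v : QuadRing a b) h2)
        using 1
      push_cast
      linear_combination (-2 * (b ^ 2 + 4 * a) : QuadRing a b) * h4
    have h5 : (q : QuadRing a b) ∈ P := by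
      obtain ⟨c, hc⟩ := hq4
      rw [← Int.cast_natCast, hc]
      convert P.mul_mem_left (2 * c : QuadRing a b) h3 using 1
      push_cast; ring
    exact key q h5 hlq.symm

variable {A : Type*} [CommGroup A] {φ : SpecialLinearGroup (Fin 2) (QuadRing a b) →* A} {q : ℕ}

theorem QuadRing.relSym_mul_pow [IsDedekindDomain (QuadRing a b)]
    (hpos : 0 < b ^ 2 + 4 * a) (hns : ¬ IsSquare (b ^ 2 + 4 * a))
    (hq4 : 4 * (b ^ 2 + 4 * a) ∣ (q : ℤ))
    (hq : ∀ x, φ (upperElem ((q : QuadRing a b) * x)) = 1)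
    {h : ℕ} (hh : 0 < h)
    (hcl : ∀ I : Ideal (QuadRing a b), I ≠ ⊥ → ∃ g, I ^ h = Ideal.span {g})
    {p : ℕ} (hp : p.Prime) (hqp : q ∣ p + 1) {X Y : ℤ} (hXY : IsCoprime X Y)
    (hz : IsCoprime (QuadraticAlgebra.norm ((X : QuadRing a b) + (Y : QuadRing a b) * delta a b))
      ((q * p * (p - 1) : ℕ) : ℤ))
    {β : QuadRing a b} (hβ : IsCoprime β (p : QuadRing a b)) :
    relSym φ (q : QuadRing a b) (-p) (β * (((X : QuadRing a b) + (Y : QuadRing a b) * delta a b) ^ h) ^ 2) =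
      relSym φ (q : QuadRing a b) (-p) β := by
  set z := (X : QuadRing a b) + (Y : QuadRing a b) * delta a b
  have hqa := dvd_neg_sub_one (a := a) (b := b) hqp
  have hnz : QuadraticAlgebra.norm z ≠ 0 := by
    intro h0
    rw [h0, isCoprime_zero_left] at hz
    have h1 : IsUnit (p : ℤ) := isUnit_of_dvd_unit ⟨q * (p - 1 : ℕ), by push_cast; ring⟩ hz
    rw [Int.isUnit_iff] at h1
    have := hp.two_le
    omega
  have hz0 : z ≠ 0 := (norm_eq_zero hns).not.1 hnz
  let Q : QuadRing a b → Prop := fun g => IsCoprime g (p : QuadRing a b) ∧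
    ∀ β : QuadRing a b, IsCoprime β (p : QuadRing a b) →
      relSym φ (q : QuadRing a b) (-p) (β * g ^ 2) = relSym φ (q : QuadRing a b) (-p) β
  have hQmul : ∀ g g', Q g → Q g' → Q (g * g') := by
    rintro g g' ⟨h1, h2⟩ ⟨h3, h4⟩
    refine ⟨h1.mul_left h3, fun β hβ => ?_⟩
    rw [mul_pow, ← mul_assoc, h4 _ (hβ.mul_left h1.pow_left), h2 _ hβ]
  have hQunit : ∀ g, IsUnit g → Q g := by
    intro g hg
    obtain ⟨v, hv⟩ := hg.exists_right_inv
    refine ⟨⟨v, 0, by linear_combination hv⟩, fun β hβ => ?_⟩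
    rw [mul_comm, relSym_unit_sq_mul_right hq hqa hβ.symm.neg_left hv]
  have key : ∀ I : Ideal (QuadRing a b), I ∣ Ideal.span {z} → ∀ g, I ^ h = Ideal.span {g} → Q g := by
    intro I
    induction I using UniqueFactorizationMonoid.induction_on_prime with
    | h₁ =>
      intro h0
      rw [zero_dvd_iff, Ideal.zero_eq_bot, Ideal.span_singleton_eq_bot] at h0
      exact absurd h0 hz0
    | h₂ I hI =>
      intro _ g hg
      rw [Ideal.isUnit_iff] at hI
      rw [hI, Ideal.top_pow, eq_comm, Ideal.span_singleton_eq_top] at hg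
      exact hQunit g hg
    | h₃ J P hJ hP ih =>
      intro hdvd g hg
      obtain ⟨π, hπ⟩ := hcl P hP.ne_zero
      obtain ⟨γ, hγ⟩ := hcl J hJ
      rw [mul_pow, hπ, hγ, Ideal.span_singleton_mul_span_singleton,
        Ideal.span_singleton_eq_span_singleton] at hg
      obtain ⟨u, rfl⟩ := hg
      refine hQmul _ _ (hQmul _ _ ?_ (ih ((dvd_mul_left _ _).trans hdvd) γ hγ)) (hQunit _ u.isUnit)
      have hP' := Ideal.isPrime_of_prime hP
      have hzP : z ∈ P := Ideal.dvd_span_singleton.1 ((dvd_mul_right _ _).trans hdvd)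
      have hnP : ((QuadraticAlgebra.norm z).natAbs : QuadRing a b) ∈ P := by
        have h1 := P.mem_of_dvd (dvd_norm z) hzP
        rcases Int.natAbs_eq (QuadraticAlgebra.norm z) with h3 | h3
        · rwa [h3, Int.cast_natCast] at h1
        · rwa [h3, Int.cast_neg, neg_mem_iff, Int.cast_natCast] at h1
      obtain ⟨l, hl, hln, hlP⟩ := hP'.exists_prime_natCast_mem (Int.natAbs_ne_zero.2 hnz) hnP
      have hlc : l.Coprime (q * p * (p - 1)) := by
        rw [Int.isCoprime_iff_nat_coprime, Int.natAbs_natCast] at hz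
        exact hz.coprime_dvd_left hln
      obtain ⟨k, hgood⟩ := good_of_prime hh hq4 hP' hπ hl hlP
        (hlc.coprime_dvd_right ⟨p * (p - 1), by ring⟩) hXY hzP
      refine ⟨?_, fun β hβ => relSym_good hpos hns hq4 hq hp hqp hgood hlc hβ⟩
      have h1 : Nat.Coprime p l := (hlc.coprime_dvd_right ⟨q * (p - 1), by ring⟩).symm
      have h2 := (Nat.isCoprime_iff_coprime.2 h1).map (Int.castRingHom (QuadRing a b))
      simp only [eq_intCast, Int.cast_natCast] at h2
      exact (hgood.isCoprime h2).symm
  exact (key _ dvd_rfl (z ^ h) (Ideal.span_singleton_pow z h)).2 β hβ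

end QuadRing

theorem Int.finite_quotient_span {n : ℤ} (hn : n ≠ 0) : Finite (ℤ ⧸ Ideal.span {n}) := by
  have : NeZero n.natAbs := ⟨Int.natAbs_ne_zero.2 hn⟩
  exact Finite.of_equiv _ (Int.quotientSpanEquivZMod n).symm.toEquiv

theorem Nat.exists_mul_eq_one_add {h W : ℕ} (hh : 0 < h) (hW : 0 < W) (hc : h.Coprime W) :
    ∃ k j : ℕ, h * k = 1 + W * j := by
  obtain ⟨k, hk⟩ := Nat.chineseRemainder hc 0 1
  obtain ⟨hk0, hk1⟩ := hk
  obtain ⟨c, hc'⟩ := (Nat.modEq_zero_iff_dvd.1 hk0)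
  rcases Nat.eq_zero_or_pos k with h0 | h0
  · subst h0
    have : W = 1 := by
      have := (Nat.modEq_zero_iff_dvd.1 hk1.symm)
      simpa using this
    exact ⟨1, h - 1, by subst this; omega⟩
  · obtain ⟨j, hj⟩ := (Nat.modEq_iff_dvd' h0).1 hk1.symm
    exact ⟨c, j, by rw [← hc', ← hj]; omega⟩

section QuadRing

variable {a b : ℤ}

open QuadraticAlgebra

variable {A : Type*} [CommGroup A] {φ : SpecialLinearGroup (Fin 2) (QuadRing a b) →* A} {q : ℕ}

theorem QuadRing.relSym_mul_sq [IsDedekindDomain (QuadRing a b)]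
    (hpos : 0 < b ^ 2 + 4 * a) (hns : ¬ IsSquare (b ^ 2 + 4 * a))
    (hq4 : 4 * (b ^ 2 + 4 * a) ∣ (q : ℤ))
    (hq : ∀ x, φ (upperElem ((q : QuadRing a b) * x)) = 1)
    {h : ℕ} (hh : 0 < h) (hhq : h ∣ q)
    (hcl : ∀ I : Ideal (QuadRing a b), I ≠ ⊥ → ∃ g, I ^ h = Ideal.span {g})
    {p : ℕ} (hp : p.Prime) (hqp : q ∣ p + 1)
    {β y : QuadRing a b} (hβ : IsCoprime β (p : QuadRing a b))
    (hy : IsCoprime y (p : QuadRing a b)) :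
    relSym φ (q : QuadRing a b) (-p) (β * y ^ 2) = relSym φ (q : QuadRing a b) (-p) β := by
  have : Fact p.Prime := ⟨hp⟩
  have hp2 := hp.two_le
  have h4q : 4 ∣ q := by exact_mod_cast (dvd_mul_right _ _).trans hq4
  have h4p : 4 ∣ p + 1 := h4q.trans hqp
  obtain ⟨W, hW⟩ : ∃ W, p = 2 * W + 1 := ⟨(p - 1) / 2, by omega⟩
  have hhW : h.Coprime W := by
    apply Nat.Coprime.of_dvd_left (hhq.trans hqp)
    have : p + 1 = 2 + W * 2 := by omega
    rw [this, Nat.coprime_add_mul_left_left, Nat.coprime_two_left, Nat.odd_iff]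
    omega
  obtain ⟨k, j, hkj⟩ := Nat.exists_mul_eq_one_add hh (by omega) hhW
  obtain ⟨f, g, hfg, hsurj, hn⟩ := exists_split (a := a) (b := b) hpos hq4 hqp
  obtain ⟨X₀, Y₀, hXY₀⟩ := hsurj (f (y ^ k)) (g (y ^ k))
  set m : ℕ := q * (p - 1) with hm
  have hm0 : (m : ZMod p) ≠ 0 := by
    intro h0
    rw [ZMod.natCast_eq_zero_iff] at h0
    rcases hp.dvd_mul.1 h0 with h1 | h1
    · have := h1.trans hqp
      rw [Nat.dvd_add_right dvd_rfl] at this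
      exact hp.one_lt.ne' (Nat.dvd_one.1 this)
    · have := Nat.le_of_dvd (by omega) h1
      omega
  have hmpos : 0 < m := Nat.pos_of_ne_zero (by rintro h0; simp [h0] at hm0)
  obtain ⟨Y, hY0, hYm, hYp⟩ : ∃ Y : ℤ, Y ≠ 0 ∧ (m : ℤ) ∣ Y ∧ (Y : ZMod p) = Y₀ := by
    refine ⟨m * (((m : ZMod p)⁻¹ * Y₀).val + p : ℕ), ?_, dvd_mul_right _ _, ?_⟩
    · have : 0 < (m : ℤ) * (((m : ZMod p)⁻¹ * Y₀).val + p : ℕ) := by positivity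
      exact this.ne'
    · push_cast
      rw [ZMod.natCast_zmod_val, ZMod.natCast_self, add_zero, mul_inv_cancel_left₀ hm0]
  obtain ⟨X₁, hX₁m, hX₁p⟩ : ∃ X : ℤ, (m : ℤ) ∣ X - 1 ∧ (X : ZMod p) = X₀ := by
    refine ⟨1 + m * (((m : ZMod p)⁻¹ * (X₀ - 1)).val : ℕ), ⟨_, add_sub_cancel_left _ _⟩, ?_⟩
    push_cast
    rw [ZMod.natCast_zmod_val, mul_inv_cancel_left₀ hm0]
    ring
  have hyf : f y * g y ≠ 0 := by
    rw [hn]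
    intro h0
    rw [ZMod.intCast_zmod_eq_zero_iff_dvd] at h0
    have := (isCoprime_natCast.1 hy).isUnit_of_dvd' h0 dvd_rfl
    rw [Int.isUnit_iff] at this
    omega
  have hNp : ∀ X Y : ℤ, (X : ZMod p) = X₀ → (Y : ZMod p) = Y₀ →
      IsCoprime (QuadraticAlgebra.norm ((X : QuadRing a b) + (Y : QuadRing a b) * delta a b)) (p : ℤ) := by
    intro X Y hX hY
    rw [isCoprime_comm, (Nat.prime_iff_prime_int.1 hp).coprime_iff_not_dvd,
      ← ZMod.intCast_zmod_eq_zero_iff_dvd, ← hn, (hXY₀ X Y hX hY).1, (hXY₀ X Y hX hY).2, map_pow,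
      map_pow, ← mul_pow]
    exact pow_ne_zero _ hyf
  obtain ⟨X, hXY, hXm, hXp⟩ : ∃ X : ℤ, IsCoprime X Y ∧ (m : ℤ) ∣ X - 1 ∧ (X : ZMod p) = X₀ := by
    have := Int.finite_quotient_span hY0
    obtain ⟨t, ht⟩ := exists_isCoprime_add_mul (R := ℤ) (a := p * m) (b := X₁) (N := Y) (by
      obtain ⟨r, s, hrs⟩ := hNp X₁ Y hX₁p hYp
      rw [norm_add_mul_delta] at hrs
      obtain ⟨c, hc⟩ := hX₁m
      refine ⟨-c * s, (1 - X₁) * r * X₁ + 1, -(1 - X₁) * r * (b ^ 2 + 4 * a) * Y, ?_⟩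
      linear_combination (1 - X₁) * hrs + s * p * hc)
    refine ⟨_, ht, ?_, ?_⟩
    · obtain ⟨c, hc⟩ := hX₁m
      exact ⟨c + t * p, by linear_combination hc⟩
    · push_cast
      simp [hX₁p]
  set z := (X : QuadRing a b) + (Y : QuadRing a b) * delta a b with hz
  have hNz := hNp X Y hXp hYp
  have hNm : IsCoprime (QuadraticAlgebra.norm z) ((q * p * (p - 1) : ℕ) : ℤ) := by
    have h1 : IsCoprime (QuadraticAlgebra.norm z) (m : ℤ) := by
      obtain ⟨c, hc⟩ := hXm
      obtain ⟨e, rfl⟩ := hYm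
      refine ⟨1, -c * (X + 1) + (b ^ 2 + 4 * a) * m * e ^ 2, ?_⟩
      rw [norm_add_mul_delta]
      linear_combination (X + 1) * hc
    have h2 := h1.mul_right hNz
    have h3 : ((q * p * (p - 1) : ℕ) : ℤ) = m * p := by rw [hm]; push_cast; ring
    rwa [h3]
  have hzp : IsCoprime z (p : QuadRing a b) := isCoprime_natCast.2 hNz
  rw [← relSym_mul_pow hpos hns hq4 hq hh hcl hp hqp hXY hNm hβ]
  have hdvd : (p : QuadRing a b) ∣ y ^ 2 - (z ^ h) ^ 2 := by
    have h1 : (p : QuadRing a b) ∣ z - y ^ k := by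
      apply hfg
      · rw [map_sub, (hXY₀ X Y hXp hYp).1, sub_self]
      · rw [map_sub, (hXY₀ X Y hXp hYp).2, sub_self]
    have h2 : (p : QuadRing a b) ∣ (z ^ h) ^ 2 - ((y ^ k) ^ h) ^ 2 :=
      (h1.trans (sub_dvd_pow_sub_pow _ _ h)).trans (sub_dvd_pow_sub_pow _ _ 2)
    have h3 : ((y ^ k) ^ h) ^ 2 = y ^ 2 * y ^ ((p - 1) * j) := by
      rw [← pow_mul, ← pow_mul, ← pow_add]
      congr 1
      have : p - 1 = 2 * W := by omega
      rw [this]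
      linear_combination 2 * hkj
    have h4 := dvd_pow_sub_one hpos hq4 hqp hy j
    obtain ⟨c, hc⟩ := h2
    obtain ⟨e, he⟩ := h4
    exact ⟨-c - y ^ 2 * e, by linear_combination -hc - y ^ 2 * he - h3⟩
  obtain ⟨c, hc⟩ := hdvd
  have h5 : β * y ^ 2 = β * (z ^ h) ^ 2 + -(p : QuadRing a b) * (-(β * c)) := by
    linear_combination β * hc
  rw [h5, relSym_add_right hq (dvd_neg_sub_one hqp)
    (hβ.mul_left hzp.pow_left.pow_left).symm.neg_left]

end QuadRing

theorem Int.exists_quadratic_pos (c₀ c₁ : ℤ) {c₂ : ℤ} (h : 0 < c₂) :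
    ∃ k : ℤ, 0 < c₀ + k * c₁ + k ^ 2 * c₂ := by
  refine ⟨|c₀| + |c₁| + 1, ?_⟩
  have h0 := abs_nonneg c₀
  have h1 := abs_nonneg c₁
  have h2 := neg_abs_le c₀
  have h3 := neg_abs_le c₁
  generalize |c₀| = x at *
  generalize |c₁| = y at *
  have h4 : (x + y + 1) ^ 2 * 1 ≤ (x + y + 1) ^ 2 * c₂ := by gcongr; omega
  have h5 : (x + y + 1) * -y ≤ (x + y + 1) * c₁ := by gcongr
  nlinarith [mul_nonneg h0 h0, mul_nonneg h0 h1]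

theorem ZMod.isSquare_or_isSquare_neg {p : ℕ} [Fact p.Prime] (hp : p % 4 = 3) (x : ZMod p) :
    IsSquare x ∨ IsSquare (-x) := by
  have h2 : ringChar (ZMod p) ≠ 2 := by rw [ZMod.ringChar_zmod_n]; omega
  by_cases h : IsSquare x
  · exact .inl h
  right
  have h1 : ¬ IsSquare (-1 : ZMod p) := by
    rw [ZMod.exists_sq_eq_neg_one_iff]; omega
  have hx : x ≠ 0 := by rintro rfl; exact h (IsSquare.zero)
  rw [← quadraticChar_neg_one_iff_not_isSquare] at h h1
  rw [← quadraticChar_one_iff_isSquare (neg_ne_zero.2 hx), neg_eq_neg_one_mul, map_mul, h, h1]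
  rfl

section QuadRing

variable {a b : ℤ}

open QuadraticAlgebra

variable {A : Type*} [CommGroup A] {φ : SpecialLinearGroup (Fin 2) (QuadRing a b) →* A} {q : ℕ}

theorem QuadRing.exists_norm_add_mul_pos (β : QuadRing a b) {n : ℤ} (hn : n ≠ 0) :
    ∃ t : QuadRing a b, 0 < QuadraticAlgebra.norm (β + (n : QuadRing a b) * t) := by
  obtain ⟨k, hk⟩ := Int.exists_quadratic_pos (QuadraticAlgebra.norm β) (n * (2 * β.re + b * β.im))
    (c₂ := n ^ 2) (by positivity)
  refine ⟨(k : QuadRing a b), ?_⟩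
  rw [norm_apply] at *
  convert hk using 1
  simp
  ring

theorem QuadRing.exists_norm_add_mul_neg (hpos : 0 < b ^ 2 + 4 * a) (β : QuadRing a b) {n : ℤ}
    (hn : n ≠ 0) : ∃ t : QuadRing a b, QuadraticAlgebra.norm (β + (n : QuadRing a b) * t) < 0 := by
  obtain ⟨k, hk⟩ := Int.exists_quadratic_pos (-QuadraticAlgebra.norm β)
    (n * (b ^ 2 + 4 * a) * β.im) (c₂ := n ^ 2 * (b ^ 2 + 4 * a)) (by positivity)
  refine ⟨(k : QuadRing a b) * delta a b, ?_⟩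
  rw [← neg_pos]
  rw [norm_apply] at *
  convert hk using 1
  simp [delta]
  ring

theorem QuadRing.relSym_natCast [IsDedekindDomain (QuadRing a b)]
    (hpos : 0 < b ^ 2 + 4 * a) (hns : ¬ IsSquare (b ^ 2 + 4 * a))
    (hq4 : 4 * (b ^ 2 + 4 * a) ∣ (q : ℤ)) (hq0 : q ≠ 0)
    (hq : ∀ x, φ (upperElem ((q : QuadRing a b) * x)) = 1)
    {h : ℕ} (hh : 0 < h) (hhq : h ∣ q)
    (hcl : ∀ I : Ideal (QuadRing a b), I ≠ ⊥ → ∃ g, I ^ h = Ideal.span {g})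
    {n : ℕ} (hn : 0 < n) (hqn : (q : ℤ) ∣ n - 1)
    {β : QuadRing a b} (hβ : IsCoprime β (n : QuadRing a b)) :
    relSym φ (q : QuadRing a b) n β = 1 := by
  have h4q : 4 ∣ q := by exact_mod_cast (dvd_mul_right _ _).trans hq4
  have hn4 : n % 4 = 1 := by
    have : (4 : ℤ) ∣ n - 1 := (by exact_mod_cast h4q : (4 : ℤ) ∣ q).trans hqn
    omega
  have hqn' : (q : QuadRing a b) ∣ n - 1 := by
    have := (intCast_dvd_intCast (a := a) (b := b)).2 hqn
    push_cast at this
    exact this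
  have hNβ := isCoprime_natCast.1 hβ
  obtain ⟨t, ht⟩ : ∃ t : QuadRing a b, (0 < QuadraticAlgebra.norm (β + (n : QuadRing a b) * t) ∧
      jacobiSym (QuadraticAlgebra.norm β) n = 1) ∨
      (QuadraticAlgebra.norm (β + (n : QuadRing a b) * t) < 0 ∧
      jacobiSym (QuadraticAlgebra.norm β) n = -1) := by
    have hn' : (n : ℤ) ≠ 0 := by exact_mod_cast hn.ne'
    rcases jacobiSym.eq_one_or_neg_one (Int.isCoprime_iff_gcd_eq_one.1 hNβ) with h1 | h1
    · obtain ⟨t, ht⟩ := exists_norm_add_mul_pos β hn'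
      exact ⟨t, .inl ⟨by rwa [Int.cast_natCast] at ht, h1⟩⟩
    · obtain ⟨t, ht⟩ := exists_norm_add_mul_neg hpos β hn'
      exact ⟨t, .inr ⟨by rwa [Int.cast_natCast] at ht, h1⟩⟩
  rw [← relSym_add_right hq hqn' hβ.symm t]
  have hβ' : IsCoprime (β + (n : QuadRing a b) * t) (n : QuadRing a b) := by
    rwa [IsCoprime.add_mul_left_left_iff]
  have hJ : jacobiSym (QuadraticAlgebra.norm (β + (n : QuadRing a b) * t)) n =
      jacobiSym (QuadraticAlgebra.norm β) n := by
    apply jacobiSym.mod_left'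
    refine (Int.modEq_iff_dvd.2 ⟨2 * β.re * t.re + n * t.re ^ 2 + b * (β.re * t.im + t.re * β.im +
      n * t.re * t.im) - a * (2 * β.im * t.im + n * t.im ^ 2), ?_⟩).symm
    rw [norm_apply, norm_apply]
    simp
    ring
  rw [← hJ] at ht
  clear hNβ hβ hJ
  generalize β + (n : QuadRing a b) * t = β at *
  clear t
  set B := QuadraticAlgebra.norm β with hB
  have hB0 : B ≠ 0 := by rcases ht with h1 | h1 <;> omega
  have hBn : IsCoprime B n := isCoprime_natCast.1 hβ'
  have hco : n.Coprime (4 * q * B.natAbs) := by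
    have h1 : n.Coprime q := by
      rw [← Nat.isCoprime_iff_coprime]
      obtain ⟨c, hc⟩ := hqn
      exact ⟨1, -c, by linear_combination hc⟩
    refine ((h1.coprime_dvd_right h4q).mul_right h1).mul_right ?_
    rw [Int.isCoprime_iff_nat_coprime] at hBn
    exact hBn.symm
  have hm0 : 4 * q * B.natAbs ≠ 0 := by simp [hq0, hB0]
  obtain ⟨p, hp, hpn⟩ : ∃ p : ℕ, p.Prime ∧ 4 * q * B.natAbs ∣ n + p := by
    have : NeZero (4 * q * B.natAbs) := ⟨hm0⟩
    obtain ⟨p, -, hp, h1⟩ := Nat.forall_exists_prime_gt_and_eq_mod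
      (q := 4 * q * B.natAbs) (a := -(n : ZMod _)) ((ZMod.unitOfCoprime n hco).isUnit.neg) 0
    refine ⟨p, hp, ?_⟩
    rw [← ZMod.natCast_eq_zero_iff]
    push_cast
    rw [h1]; ring
  have : Fact p.Prime := ⟨hp⟩
  have hqp : q ∣ p + 1 := by
    have h1 : (q : ℤ) ∣ n + p := by
      exact_mod_cast (Dvd.intro (4 * B.natAbs) (by ring) : q ∣ 4 * q * B.natAbs).trans hpn
    have h2 := dvd_sub h1 hqn
    have h3 : (n + p - (n - 1) : ℤ) = ((p + 1 : ℕ) : ℤ) := by push_cast; ring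
    rw [h3] at h2
    exact_mod_cast h2
  have hp4 : p % 4 = 3 := by
    have := h4q.trans hqp
    omega
  have hJp : jacobiSym B p = 1 :=
    jacobiSym_eq_one_of_dvd_add hn4 ((Dvd.intro q (by ring)).trans hpn) ht
  have hβp : IsCoprime β (p : QuadRing a b) := by
    rw [isCoprime_natCast, ← hB]
    by_contra h1
    rw [Int.isCoprime_iff_gcd_eq_one] at h1
    rw [jacobiSym.eq_zero_iff.2 ⟨hp.ne_zero, h1⟩] at hJp
    exact zero_ne_one hJp
  have hstep : relSym φ (q : QuadRing a b) n β = relSym φ (q : QuadRing a b) (-p) β := by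
    obtain ⟨c, hc⟩ : (q : ℤ) * B ∣ n + p := by
      have : ((q * B.natAbs : ℕ) : ℤ) ∣ n + p := by
        exact_mod_cast (Dvd.intro_left 4 (by ring) : q * B.natAbs ∣ 4 * q * B.natAbs).trans hpn
      rw [Nat.cast_mul, Int.natCast_natAbs] at this
      exact ((mul_dvd_mul_left _ (self_dvd_abs B))).trans this
    rw [← relSym_add_left hq hqn' hβ'.symm (-(star β * c))]
    congr 1
    have h1 := mul_star_self β
    rw [← hB] at h1
    have h2 := congrArg (Int.cast : ℤ → QuadRing a b) hc
    push_cast at h2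
    linear_combination h2 - q * c * h1
  rw [hstep]
  obtain ⟨f, g, hfg, hsurj, hnm⟩ := exists_split (a := a) (b := b) hpos hq4 hqp
  obtain ⟨r, hr⟩ := ZMod.isSquare_of_jacobiSym_eq_one hJp
  have hf0 : f β ≠ 0 := by
    have := hβp.map f
    rw [map_natCast, ZMod.natCast_self, isCoprime_zero_right] at this
    exact this.ne_zero
  have hfgB : f β * g β = r * r := by rw [hnm, ← hB, hr]
  obtain ⟨ε, hε, s, hs⟩ : ∃ ε : ℤ, ε * ε = 1 ∧ IsSquare ((ε : ZMod p) * f β) := by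
    rcases ZMod.isSquare_or_isSquare_neg hp4 (f β) with h1 | h1
    · exact ⟨1, by norm_num, by simpa using h1⟩
    · exact ⟨-1, by norm_num, by simpa using h1⟩
  obtain ⟨X₀, Y₀, hXY⟩ := hsurj s (ε * r * s / f β)
  obtain ⟨X, hX⟩ := ZMod.intCast_surjective X₀
  obtain ⟨Y, hY⟩ := ZMod.intCast_surjective Y₀
  obtain ⟨hz1, hz2⟩ := hXY X Y hX hY
  set z := (X : QuadRing a b) + (Y : QuadRing a b) * delta a b
  have hεp : (ε : ZMod p) * ε = 1 := by exact_mod_cast congrArg (Int.cast : ℤ → ZMod p) hε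
  have hεR : (ε : QuadRing a b) * ε = 1 := by
    exact_mod_cast congrArg (Int.cast : ℤ → QuadRing a b) hε
  have hdvd : (p : QuadRing a b) ∣ β - ε * z ^ 2 := by
    apply hfg
    · rw [map_sub, map_mul, map_pow, hz1, map_intCast]
      linear_combination ε * hs - f β * hεp
    · rw [map_sub, map_mul, map_pow, hz2, map_intCast]
      have h1 : (ε * r * s / f β) ^ 2 = ε * g β := by
        field_simp
        linear_combination r ^ 2 * s ^ 2 * hεp - s ^ 2 * hfgB - f β * g β * hs
      linear_combination -ε * h1 - g β * hεp
  have hzp : IsCoprime z (p : QuadRing a b) := by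
    obtain ⟨c, hc⟩ := hdvd
    obtain ⟨u, v, huv⟩ := hβp
    exact ⟨u * ε * z, v + u * c, by linear_combination huv - u * hc⟩
  have hεu : IsUnit (ε : QuadRing a b) := .of_mul_eq_one _ hεR
  obtain ⟨c, hc⟩ := hdvd
  have h5 : β = ε * z ^ 2 + -(p : QuadRing a b) * -c := by linear_combination hc
  have hεp : IsCoprime (ε : QuadRing a b) (p : QuadRing a b) := ⟨ε, 0, by linear_combination hεR⟩
  rw [h5, relSym_add_right hq (dvd_neg_sub_one hqp) (hεp.mul_left hzp.pow_left).symm.neg_left,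
    relSym_mul_sq hpos hns hq4 hq hh hhq hcl hp hqp hεp hzp,
    relSym_unit hq (dvd_neg_sub_one hqp) hεu]

end QuadRing

section QuadRing

variable {a b : ℤ}

open QuadraticAlgebra

variable {A : Type*} [CommGroup A] {φ : SpecialLinearGroup (Fin 2) (QuadRing a b) →* A} {q : ℕ}

theorem QuadRing.exists_isCoprime_re_im (hns : ¬ IsSquare (b ^ 2 + 4 * a)) {α β : QuadRing a b}
    (hα : α ≠ 0) (h : IsCoprime α β) :
    ∃ t, IsCoprime (β + α * t).re (β + α * t).im ∧ (β + α * t).im ≠ 0 := by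
  set N := QuadraticAlgebra.norm α with hN
  have hN0 : N ≠ 0 := (norm_eq_zero hns).not.2 hα
  have hαN : α * star α = (N : QuadRing a b) := mul_star_self α
  obtain ⟨s, hs⟩ : ∃ s : ℤ, β.im + N * s ≠ 0 := by
    by_cases h0 : β.im = 0
    · exact ⟨1, by simpa [h0] using hN0⟩
    · exact ⟨0, by simpa using h0⟩
  set γ : QuadRing a b := ⟨β.re, β.im + N * s⟩ with hγ
  have hγβ : γ = β + α * (star α * (s * ⟨0, 1⟩)) := by
    rw [← mul_assoc, hαN]
    ext <;> simp [hγ]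
  have hc : IsCoprime α γ := by
    rw [hγβ]
    exact (IsCoprime.add_mul_left_right_iff).2 h
  have := Int.finite_quotient_span hs
  obtain ⟨k, hk⟩ := exists_isCoprime_add_mul (R := ℤ) (a := N) (b := γ.re) (N := γ.im) (by
    have h1 : ((Int.gcd γ.re γ.im : ℤ) : QuadRing a b) ∣ γ :=
      intCast_dvd.2 ⟨Int.gcd_dvd_left .., Int.gcd_dvd_right ..⟩
    obtain ⟨u, v, huv⟩ := isCoprime_norm (hc.of_isCoprime_of_dvd_right h1)
    rw [Int.gcd_eq_gcd_ab] at huv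
    exact ⟨u, v * Int.gcdA γ.re γ.im, v * Int.gcdB γ.re γ.im, by rw [← huv]; ring⟩)
  have heq : β + α * (star α * (s * ⟨0, 1⟩ + k)) = ⟨γ.re + k * N, γ.im⟩ := by
    rw [mul_add, mul_add, ← add_assoc, ← hγβ, ← mul_assoc, hαN]
    ext <;> simp
    ring
  exact ⟨star α * (s * ⟨0, 1⟩ + k), by rw [heq]; exact ⟨hk, hs⟩⟩

theorem QuadRing.relSym_eq_one [IsDedekindDomain (QuadRing a b)]
    (hpos : 0 < b ^ 2 + 4 * a) (hns : ¬ IsSquare (b ^ 2 + 4 * a))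
    (hq4 : 4 * (b ^ 2 + 4 * a) ∣ (q : ℤ)) (hq0 : q ≠ 0)
    (hq : ∀ x, φ (upperElem ((q : QuadRing a b) * x)) = 1)
    {h : ℕ} (hh : 0 < h) (hhq : h ∣ q)
    (hcl : ∀ I : Ideal (QuadRing a b), I ≠ ⊥ → ∃ g, I ^ h = Ideal.span {g})
    {α β : QuadRing a b} (hα : (q : QuadRing a b) ∣ α - 1) (hβ : IsCoprime α β) :
    relSym φ (q : QuadRing a b) α β = 1 := by
  have hα0 : α ≠ 0 := by
    rintro rfl
    rw [zero_sub, dvd_neg] at hα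
    have h1 : q ∣ 1 := natCast_dvd_natCast.1 (by rwa [Nat.cast_one])
    have h4q : 4 ∣ q := by exact_mod_cast (dvd_mul_right _ _).trans hq4
    exact absurd (h4q.trans h1) (by norm_num)
  obtain ⟨t, ht, ht0⟩ := exists_isCoprime_re_im hns hα0 hβ
  rw [← relSym_add_right hq hα hβ t]
  have hβ : IsCoprime α (β + α * t) := (IsCoprime.add_mul_left_right_iff).2 hβ
  generalize β + α * t = β at *
  have hβ0 : QuadraticAlgebra.norm β ≠ 0 := by
    rw [Ne, norm_eq_zero hns]
    rintro rfl
    exact ht0 rfl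
  obtain ⟨c, hc⟩ := hα
  obtain ⟨m, e, he⟩ := exists_int_dvd_sub ht c
  set N := QuadraticAlgebra.norm β with hN
  set n : ℤ := 1 + q * m + q * N * (N * (|1 + q * m| + 1)) with hn
  have hn0 : 0 < n := by
    have h1 := neg_abs_le (1 + q * m)
    have h2 := abs_nonneg (1 + q * m)
    have h3 : 1 * (|1 + q * m| + 1) ≤ (q * N ^ 2) * (|1 + q * m| + 1) := by
      gcongr
      have : 0 < q * N ^ 2 := by positivity
      omega
    rw [hn]
    linarith [h3]
  lift n to ℕ using hn0.le with n'
  have hn' : (n' : QuadRing a b) = α + q * β * (star β * (N * (|1 + q * m| + 1) : ℤ) - e) := by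
    have h1 := mul_star_self β
    rw [← hN] at h1
    generalize N * (|1 + q * m| + 1) = K at hn ⊢
    have h2 := congrArg (Int.cast : ℤ → QuadRing a b) hn
    push_cast at h2
    linear_combination h2 - hc - q * he - q * K * h1
  rw [← relSym_add_left hq ⟨c, hc⟩ hβ, ← hn']
  refine relSym_natCast hpos hns hq4 hq0 hq hh hhq hcl (by exact_mod_cast hn0)
    ⟨m + N * (N * (|1 + q * m| + 1)), by rw [hn]; ring⟩ ?_
  rw [hn', isCoprime_comm, mul_comm _ β, mul_assoc]
  exact (IsCoprime.add_mul_left_left_iff).2 hβ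

theorem QuadRing.map_eq_one_of_modEq [IsDedekindDomain (QuadRing a b)]
    (hpos : 0 < b ^ 2 + 4 * a) (hns : ¬ IsSquare (b ^ 2 + 4 * a))
    (hq4 : 4 * (b ^ 2 + 4 * a) ∣ (q : ℤ)) (hq0 : q ≠ 0)
    (hq : ∀ x, φ (upperElem ((q : QuadRing a b) * x)) = 1)
    {h : ℕ} (hh : 0 < h) (hhq : h ∣ q)
    (hcl : ∀ I : Ideal (QuadRing a b), I ≠ ⊥ → ∃ g, I ^ h = Ideal.span {g})
    {M : SpecialLinearGroup (Fin 2) (QuadRing a b)} (h00 : (q : QuadRing a b) ∣ M 0 0 - 1)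
    (h01 : (q : QuadRing a b) ∣ M 0 1) (h10 : (q : QuadRing a b) ∣ M 1 0) : φ M = 1 := by
  obtain ⟨β, hβ⟩ := h01
  rw [map_eq_relSym hq rfl hβ h10]
  refine relSym_eq_one hpos hns hq4 hq0 hq hh hhq hcl h00 ⟨M 1 1, -q * M 1 0, ?_⟩
  have := sl2_det M
  rw [hβ] at this
  linear_combination this

/-- A homomorphism from `SL₂` of a real quadratic order that is Dedekind to a commutative group is
trivial on a principal congruence subgroup, of level divisible by any given integer. -/
theorem QuadRing.exists_level [IsDedekindDomain (QuadRing a b)]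
    (hpos : 0 < b ^ 2 + 4 * a) (hns : ¬ IsSquare (b ^ 2 + 4 * a))
    {h : ℕ} (hh : 0 < h)
    (hcl : ∀ I : Ideal (QuadRing a b), I ≠ ⊥ → ∃ g, I ^ h = Ideal.span {g})
    (φ : SpecialLinearGroup (Fin 2) (QuadRing a b) →* A) (m : ℕ) (hm : m ≠ 0) :
    ∃ q : ℕ, q ≠ 0 ∧ m ∣ q ∧ (∀ x, φ (upperElem ((q : QuadRing a b) * x)) = 1) ∧
      ∀ M : SpecialLinearGroup (Fin 2) (QuadRing a b), (q : QuadRing a b) ∣ M 0 0 - 1 →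
        (q : QuadRing a b) ∣ M 0 1 → (q : QuadRing a b) ∣ M 1 0 → φ M = 1 := by
  obtain ⟨u, v, huv, -, hu⟩ := exists_unit hpos hns (m := (1 : QuadRing a b)) one_ne_zero
  set N := QuadraticAlgebra.norm (u ^ 2 - 1) with hN
  have hN0 : N ≠ 0 := (norm_eq_zero hns).not.2 (sub_ne_zero.2 hu)
  refine ⟨m * (4 * (b ^ 2 + 4 * a).natAbs * h * N.natAbs), ?_, dvd_mul_right _ _, ?_⟩
  · have : (b ^ 2 + 4 * a).natAbs ≠ 0 := Int.natAbs_ne_zero.2 hpos.ne'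
    have := Int.natAbs_ne_zero.2 hN0
    positivity
  set q := m * (4 * (b ^ 2 + 4 * a).natAbs * h * N.natAbs) with hq
  have hqu : ∀ x, φ (upperElem ((q : QuadRing a b) * x)) = 1 := by
    intro x
    obtain ⟨y, hy⟩ : u ^ 2 - 1 ∣ (q : QuadRing a b) := by
      refine (dvd_norm _).trans ?_
      rw [← hN, ← Int.cast_natCast, intCast_dvd_intCast, hq]
      push_cast
      rw [← mul_assoc]
      exact Dvd.dvd.mul_left (by simp) _
    have h1 := map_upperElem_sq φ huv (y * x)
    have h2 : (q : QuadRing a b) * x = u ^ 2 * (y * x) + -(y * x) := by rw [hy]; ring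
    rw [h2, map_upperElem_add, map_upperElem_neg, h1, mul_inv_cancel]
  refine ⟨hqu, fun M h00 h01 h10 => map_eq_one_of_modEq hpos hns ?_ ?_ hqu hh ?_ hcl h00 h01 h10⟩
  · rw [hq]
    push_cast
    rw [abs_of_pos hpos]
    exact ⟨m * h * |N|, by ring⟩
  · have : (b ^ 2 + 4 * a).natAbs ≠ 0 := Int.natAbs_ne_zero.2 hpos.ne'
    have := Int.natAbs_ne_zero.2 hN0
    positivity
  · exact ⟨m * (4 * (b ^ 2 + 4 * a).natAbs * N.natAbs), by rw [hq]; ring⟩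

end QuadRing

section ElemKer

variable {R A : Type*} [CommRing R] [CommGroup A] (φ : SpecialLinearGroup (Fin 2) R →* A)

/-- The additive subgroup of those `x` for which `φ (upperElem x) = 1`. -/
def elemKer : AddSubgroup R where
  carrier := {x | φ (upperElem x) = 1}
  zero_mem' := by simp
  add_mem' {x y} hx hy := by
    rw [Set.mem_ofPred_eq] at *
    rw [map_upperElem_add, hx, hy, mul_one]
  neg_mem' {x} hx := by
    rw [Set.mem_ofPred_eq] at *
    rw [map_upperElem_neg, hx, inv_one]

variable {φ}

theorem mem_elemKer {x : R} : x ∈ elemKer φ ↔ φ (upperElem x) = 1 := Iff.rfl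

theorem sub_mem_elemKer {x y : R} : x - y ∈ elemKer φ ↔ φ (upperElem x) = φ (upperElem y) := by
  rw [mem_elemKer, sub_eq_add_neg, map_upperElem_add, map_upperElem_neg, mul_inv_eq_one]

theorem sq_sub_one_mul_mem_elemKer {u v : R} (h : u * v = 1) (x : R) :
    (u ^ 2 - 1) * x ∈ elemKer φ := by
  rw [sub_mul, one_mul, sub_mem_elemKer, map_upperElem_sq φ h]

theorem three_mul_mem_elemKer {u v u' v' : R} (h : u * v = 1) (h' : u' * v' = 1) :
    3 * ((u - 1) * (u' - 1)) ∈ elemKer φ := by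
  have h'' : u * u' * (v * v') = 1 := by linear_combination u' * v' * h + h'
  have h1 : 2 * (u * u') + v * v' - 3 - ((2 * u + v - 3) + (2 * u' + v' - 3)) ∈ elemKer φ := by
    rw [sub_mem_elemKer, map_upperElem_add, ← map_diag φ h, ← map_diag φ h', ← map_diag φ h'',
      ← map_mul]
    congr 1
    apply sl2_ext <;> simp [sl2_mul_apply]
  have h2 := add_mem (sub_mem (sub_mem h1 (sq_sub_one_mul_mem_elemKer h v))
    (sq_sub_one_mul_mem_elemKer h' v')) (sq_sub_one_mul_mem_elemKer (φ := φ) h'' (v * v'))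
  convert h2 using 1
  linear_combination u * h + u' * h' - u * u' * h''

theorem exists_eq_map_upperElem (h : elemSubgroup R = ⊤) (M : SpecialLinearGroup (Fin 2) R) :
    ∃ x, φ M = φ (upperElem x) := by
  have hM : M ∈ elemSubgroup R := h ▸ Subgroup.mem_top M
  induction hM using Subgroup.closure_induction with
  | mem M hM =>
    rcases hM with ⟨x, rfl⟩ | ⟨x, rfl⟩
    · exact ⟨x, rfl⟩
    · exact ⟨-x, map_lowerElem φ x⟩
  | one => exact ⟨0, by simp⟩
  | mul M N _ _ hM hN =>
    obtain ⟨x, hx⟩ := hM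
    obtain ⟨y, hy⟩ := hN
    exact ⟨x + y, by rw [map_mul, hx, hy, map_upperElem_add]⟩
  | inv M _ hM =>
    obtain ⟨x, hx⟩ := hM
    exact ⟨-x, by rw [map_inv, hx, map_upperElem_neg]⟩

end ElemKer

section Quotient

variable {R S A : Type*} [CommRing R] [CommRing S] [CommGroup A]

theorem map_upperElem (f : R →+* S) (x : R) :
    SpecialLinearGroup.map f (upperElem x) = upperElem (f x) := by
  apply sl2_ext <;> simp

theorem map_lowerElem' (f : R →+* S) (x : R) :
    SpecialLinearGroup.map f (lowerElem x) = lowerElem (f x) := by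
  apply sl2_ext <;> simp

theorem sl2_map_surjective {f : R →+* S} (hf : Function.Surjective f) (hS : elemSubgroup S = ⊤) :
    Function.Surjective (SpecialLinearGroup.map (n := Fin 2) f) := by
  rw [← MonoidHom.range_eq_top, eq_top_iff, ← hS, elemSubgroup, Subgroup.closure_le]
  rintro _ (⟨x, rfl⟩ | ⟨x, rfl⟩) <;> obtain ⟨x, rfl⟩ := hf x
  · exact ⟨_, map_upperElem f x⟩
  · exact ⟨_, map_lowerElem' f x⟩

theorem exists_comp_map_eq {f : R →+* S} (hf : Function.Surjective f) (hS : elemSubgroup S = ⊤)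
    (φ : SpecialLinearGroup (Fin 2) R →* A)
    (hφ : ∀ M, SpecialLinearGroup.map f M = 1 → φ M = 1) :
    ∃ ψ : SpecialLinearGroup (Fin 2) S →* A, ψ.comp (SpecialLinearGroup.map f) = φ := by
  have h := sl2_map_surjective hf hS
  exact ⟨_, MonoidHom.liftOfRightInverse_comp _ _ (Function.rightInverse_surjInv h) ⟨φ, hφ⟩⟩

end Quotient

section QuadRing

variable {a b : ℤ}

open QuadraticAlgebra

variable {A : Type*} [CommGroup A] {φ : SpecialLinearGroup (Fin 2) (QuadRing a b) →* A}

/-- The ideal of those `y` all of whose multiples lie in `elemKer φ`. -/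
def elemKerIdeal {R A : Type*} [CommRing R] [CommGroup A]
    (φ : SpecialLinearGroup (Fin 2) R →* A) : Ideal R where
  carrier := {y | ∀ x, y * x ∈ elemKer φ}
  zero_mem' x := by rw [zero_mul]; exact zero_mem _
  add_mem' {y z} hy hz x := by rw [add_mul]; exact add_mem (hy x) (hz x)
  smul_mem' r y hy x := by rw [smul_eq_mul, mul_comm r, mul_assoc]; exact hy _

theorem Int.exists_coprime_sq_sub_one {q : ℕ} (hq : q ≠ 0) :
    ∃ u : ℤ, IsCoprime u q ∧ ∃ x y : ℤ, x * (u ^ 2 - 1) + y * q = 24 := by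
  obtain ⟨i, m, hm, hq⟩ := Nat.exists_eq_two_pow_mul_odd hq
  have hc : Nat.Coprime m (2 ^ (i + 3)) := by
    rw [Nat.coprime_comm, Nat.coprime_pow_left_iff (by omega), Nat.coprime_two_left]
    exact hm
  obtain ⟨u, hu2, hu3⟩ := Nat.chineseRemainder hc 2 3
  obtain ⟨c, hc2⟩ := (Int.natCast_modEq_iff.2 hu2).symm.dvd
  obtain ⟨e, hc3⟩ := (Int.natCast_modEq_iff.2 hu3).symm.dvd
  obtain ⟨r, s, hrs⟩ := Nat.isCoprime_iff_coprime.2 hc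
  push_cast at hc2 hc3 hrs
  obtain ⟨k, hk⟩ := hm
  have hk' : (m : ℤ) = 2 * k + 1 := by exact_mod_cast hk
  have hcop1 : IsCoprime (u : ℤ) m := ⟨-k, 1 + k * c, by linear_combination -k * hc2 + hk'⟩
  have hcop2 : IsCoprime (u : ℤ) (2 ^ (i + 3)) := by
    apply IsCoprime.pow_right
    exact ⟨1, -1 - 2 ^ (i + 2) * e, by rw [pow_add] at *; linear_combination hc3⟩
  refine ⟨u, ?_, ?_⟩
  · rw [hq]
    push_cast
    exact (hcop2.of_isCoprime_of_dvd_right ⟨8, by ring⟩).mul_right hcop1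
  · rw [hq]
    push_cast
    have h1 : ∃ x y : ℤ, x * (u ^ 2 - 1) + y * m = 24 :=
      ⟨8, -8 * c * (u + 2), by linear_combination 8 * (u + 2) * hc2⟩
    have h2 : ∃ x y : ℤ, x * (u ^ 2 - 1) + y * 2 ^ i = 24 := by
      refine ⟨3, -24 * e * (u + 3), ?_⟩
      rw [pow_add] at hc3
      linear_combination 3 * (u + 3) * hc3
    obtain ⟨x, y, hxy⟩ := h1
    obtain ⟨z, w, hzw⟩ := h2
    -- combine using coprimality of `m` and `2 ^ (i + 3)`
    refine ⟨r * m * z + s * 2 ^ (i + 3) * x, r * w + s * 8 * y, ?_⟩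
    rw [pow_add] at *
    linear_combination r * m * hzw + s * (2 ^ i * 2 ^ 3) * hxy + 24 * hrs

theorem QuadRing.elemKer_facts [IsDedekindDomain (QuadRing a b)]
    (hpos : 0 < b ^ 2 + 4 * a) (hns : ¬ IsSquare (b ^ 2 + 4 * a))
    {h : ℕ} (hh : 0 < h)
    (hcl : ∀ I : Ideal (QuadRing a b), I ≠ ⊥ → ∃ g, I ^ h = Ideal.span {g})
    (φ : SpecialLinearGroup (Fin 2) (QuadRing a b) →* A) :
    (∀ M, ∃ x, φ M = φ (upperElem x)) ∧
    (24 : QuadRing a b) ∈ elemKerIdeal φ ∧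
    (∀ u, IsCoprime (QuadraticAlgebra.norm u) 6 → u ^ 2 - 1 ∈ elemKerIdeal φ) ∧
    (∀ u u', IsCoprime (QuadraticAlgebra.norm u) 6 → IsCoprime (QuadraticAlgebra.norm u') 6 →
      3 * ((u - 1) * (u' - 1)) ∈ elemKer φ) := by
  obtain ⟨q, hq0, -, hq, hΓ⟩ := exists_level hpos hns hh hcl φ 1 one_ne_zero
  have hqR : (q : QuadRing a b) ≠ 0 := by
    intro h0
    have := (natCast_dvd_natCast (a := a) (b := b) (m := 0) (n := q)).1 (by rw [h0]; simp)
    exact hq0 (by simpa using this)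
  have := finite_quotient hns hqR
  set π := Ideal.Quotient.mk (Ideal.span {(q : QuadRing a b)}) with hπ
  have hπ0 : ∀ x, π x = 0 ↔ (q : QuadRing a b) ∣ x := fun x => by
    rw [hπ, Ideal.Quotient.eq_zero_iff_mem, Ideal.mem_span_singleton]
  have hπs : Function.Surjective π := Ideal.Quotient.mk_surjective
  have htop := elemSubgroup_eq_top_of_finite (R := QuadRing a b ⧸ Ideal.span {(q : QuadRing a b)})
  obtain ⟨ψ, hψ⟩ := exists_comp_map_eq hπs htop φ (fun M hM => by
    have key : ∀ i j, π (M i j) = (1 : SpecialLinearGroup (Fin 2) _) i j := fun i j => by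
      rw [← hM]; rfl
    refine hΓ M ?_ ?_ ?_
    · rw [← hπ0, map_sub, key, map_one, sl2_one_00, sub_self]
    · rw [← hπ0, key, sl2_one_01]
    · rw [← hπ0, key, sl2_one_10])
  have hφψ : ∀ x, x ∈ elemKer φ ↔ π x ∈ elemKer ψ := fun x => by
    rw [mem_elemKer, mem_elemKer, ← hψ, MonoidHom.comp_apply, map_upperElem]
  have hqJ : (q : QuadRing a b) ∈ elemKerIdeal φ := fun x => hq x
  have hunit : ∀ u, IsCoprime u (q : QuadRing a b) → ∃ v, π u * π v = 1 := by
    rintro u ⟨v, w, hvw⟩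
    refine ⟨v, ?_⟩
    rw [← map_mul, ← sub_eq_zero, ← map_one π, ← map_sub, hπ0]
    exact ⟨-w, by linear_combination hvw⟩
  have hsq : ∀ u, IsCoprime u (q : QuadRing a b) → u ^ 2 - 1 ∈ elemKerIdeal φ := by
    intro u hu x
    obtain ⟨v, hv⟩ := hunit u hu
    rw [hφψ, map_mul, map_sub, map_pow, map_one]
    exact sq_sub_one_mul_mem_elemKer hv _
  have hthree : ∀ u u', IsCoprime u (q : QuadRing a b) → IsCoprime u' (q : QuadRing a b) →
      3 * ((u - 1) * (u' - 1)) ∈ elemKer φ := by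
    intro u u' hu hu'
    obtain ⟨v, hv⟩ := hunit u hu
    obtain ⟨v', hv'⟩ := hunit u' hu'
    rw [hφψ, map_mul, map_mul, map_sub, map_sub, map_one, map_ofNat]
    exact three_mul_mem_elemKer hv hv'
  have h24 : (24 : QuadRing a b) ∈ elemKerIdeal φ := by
    obtain ⟨u, hu, x, y, hxy⟩ := Int.exists_coprime_sq_sub_one hq0
    have h1 : IsCoprime (u : QuadRing a b) (q : QuadRing a b) := by
      have := hu.map (Int.castRingHom (QuadRing a b))
      simpa using this
    have h2 := add_mem (Ideal.mul_mem_left _ (x : QuadRing a b) (hsq u h1))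
      (Ideal.mul_mem_left _ (y : QuadRing a b) hqJ)
    have h3 := congrArg (Int.cast : ℤ → QuadRing a b) hxy
    push_cast at h3
    rwa [h3] at h2
  have hlift : ∀ u : QuadRing a b, IsCoprime (QuadraticAlgebra.norm u) 6 →
      ∃ t, IsCoprime (u + t * 24) (q : QuadRing a b) := by
    intro u hu
    apply exists_isCoprime_add_mul
    have h1 : IsCoprime u ((24 : ℤ) : QuadRing a b) := by
      rw [isCoprime_iff_norm]
      exact (hu.pow_right (n := 3)).of_isCoprime_of_dvd_right ⟨9, by norm_num⟩
    obtain ⟨x, y, hxy⟩ := h1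
    exact ⟨y, x, 0, by rw [← hxy]; push_cast; ring⟩
  refine ⟨fun M => ?_, h24, fun u hu => ?_, fun u u' hu hu' => ?_⟩
  · obtain ⟨x, hx⟩ := exists_eq_map_upperElem (φ := ψ) htop (SpecialLinearGroup.map π M)
    obtain ⟨x, rfl⟩ := hπs x
    refine ⟨x, ?_⟩
    rw [← map_upperElem] at hx
    rw [← hψ]
    exact hx
  · obtain ⟨t, ht⟩ := hlift u hu
    have := sub_mem (hsq _ ht) (Ideal.mul_mem_left _ (2 * u * t + 24 * t ^ 2) h24)
    convert this using 1
    ring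
  · obtain ⟨t, ht⟩ := hlift u hu
    obtain ⟨t', ht'⟩ := hlift u' hu'
    have := sub_mem (hthree _ _ ht ht') (h24 (3 * (t * (u' - 1) + t' * (u - 1) + 24 * t * t')))
    convert this using 1
    ring

end QuadRing

section QuadRing

variable {a b : ℤ}

open QuadraticAlgebra

theorem Ideal.mem_of_odd_mul_mem {R : Type*} [CommRing R] {I : Ideal R} {c : R} {n : ℤ} (hn : Odd n)
    (h : c * n ∈ I) (h8 : c * 8 ∈ I) : c ∈ I := by
  have h1 : IsCoprime n 8 := by
    have : IsCoprime n 2 := by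
      obtain ⟨k, rfl⟩ := hn
      exact ⟨1, -k, by ring⟩
    exact this.pow_right (n := 3)
  obtain ⟨x, y, hxy⟩ := h1
  have h2 := I.add_mem (I.mul_mem_left (x : R) h) (I.mul_mem_left (y : R) h8)
  have h3 := congrArg (Int.cast : ℤ → R) hxy
  push_cast at h3
  have h4 : c = x * (c * n) + y * (c * 8) := by linear_combination -c * h3
  rwa [h4]

theorem Int.isCoprime_six {n : ℤ} (h2 : n % 2 = 1) (h3 : n % 3 = 1) : IsCoprime n 6 :=
  ⟨1, -(n / 6), by omega⟩

variable {J : Ideal (QuadRing a b)} (h24 : (24 : QuadRing a b) ∈ J)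
  (hJ : ∀ u, IsCoprime (QuadraticAlgebra.norm u) 6 → u ^ 2 - 1 ∈ J)

include h24 hJ

theorem QuadRing.eight_mem (h : (b ^ 2 + 4 * a) % 3 = 2) : (8 : QuadRing a b) ∈ J := by
  obtain ⟨k, hk⟩ : ∃ k, b ^ 2 + 4 * a = 3 * k + 2 := ⟨(b ^ 2 + 4 * a) / 3, by omega⟩
  have h1 := hJ ((9 : ℤ) + (16 : ℤ) * delta a b) (by
    rw [norm_add_mul_delta, hk]
    apply Int.isCoprime_six <;> omega)
  have h2 := delta_mul_self (a := a) (b := b)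
  rw [hk] at h2
  push_cast at h1 h2
  have h3 := sub_mem h1 (J.mul_mem_left (32 * k + 24 + 12 * delta a b) h24)
  have h4 := sub_mem h24 h3
  convert h4 using 1
  linear_combination 256 * h2

theorem QuadRing.eight_mul_delta_mem (h : (b ^ 2 + 4 * a) % 3 = 0) : 8 * delta a b ∈ J := by
  obtain ⟨k, hk⟩ : ∃ k, b ^ 2 + 4 * a = 3 * k := ⟨(b ^ 2 + 4 * a) / 3, by omega⟩
  have h1 := hJ ((25 : ℤ) + (16 : ℤ) * delta a b) (by
    rw [norm_add_mul_delta, hk]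
    apply Int.isCoprime_six <;> omega)
  have h2 := delta_mul_self (a := a) (b := b)
  rw [hk] at h2
  push_cast at h1 h2
  have h3 := sub_mem h1 (J.mul_mem_left (32 * k + 26 + 33 * delta a b) h24)
  convert h3 using 1
  linear_combination -256 * h2

theorem QuadRing.three_mem (hb : b = 1) (ha : a % 2 = 1) : (3 : QuadRing a b) ∈ J := by
  subst hb
  obtain ⟨k, rfl⟩ : ∃ k, a = 2 * k + 1 := ⟨a / 2, by omega⟩
  have h1 := hJ ⟨16, 9⟩ (by
    rw [norm_apply]
    apply Int.isCoprime_six <;> simp <;> ring_nf <;> omega)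
  set w : QuadRing (2 * k + 1) 1 := ⟨6 * k, 3⟩ with hw
  have h2 : 3 * w ∈ J := by
    have h3 := sub_mem h1 (J.mul_mem_left (⟨14 + 6 * k, 15⟩) h24)
    convert h3 using 1
    ext <;> simp [hw, pow_two] <;> ring
  refine Ideal.mem_of_odd_mul_mem (n := QuadraticAlgebra.norm w) ?_ ?_ (by norm_num [h24])
  · rw [norm_apply, hw, Int.odd_iff]
    simp
    ring_nf
    omega
  · rw [← mul_star_self, ← mul_assoc]
    exact J.mul_mem_right _ h2

theorem QuadRing.six_mem (hb : b = 0) (ha : a % 4 = 2 ∨ a % 4 = 3) : (6 : QuadRing a b) ∈ J := by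
  subst hb
  have h24' : (6 * 8 : QuadRing a 0) ∈ J := by
    convert J.mul_mem_left 2 h24 using 1
    norm_num
  rcases ha with ha | ha
  · obtain ⟨k, rfl⟩ : ∃ k, a = 4 * k + 2 := ⟨a / 4, by omega⟩
    have h1 := hJ ⟨1, 9⟩ (by
      rw [norm_apply]
      apply Int.isCoprime_six <;> simp <;> ring_nf <;> omega)
    set w : QuadRing (4 * k + 2) 0 := ⟨2 * k + 1, 1⟩ with hw
    have h2 : 6 * w ∈ J := by
      have h3 := sub_mem (J.mul_mem_left 3 h1) (J.mul_mem_left ⟨40 * k + 20, 2⟩ h24)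
      convert h3 using 1
      ext <;> simp [hw, pow_two] <;> ring
    refine Ideal.mem_of_odd_mul_mem (n := QuadraticAlgebra.norm w) ?_ ?_ h24'
    · rw [norm_apply, hw, Int.odd_iff]
      simp
      ring_nf
      omega
    · rw [← mul_star_self, ← mul_assoc]
      exact J.mul_mem_right _ h2
  · obtain ⟨k, rfl⟩ : ∃ k, a = 4 * k + 3 := ⟨a / 4, by omega⟩
    have h1 := hJ ⟨16, 9⟩ (by
      rw [norm_apply]
      apply Int.isCoprime_six <;> simp <;> ring_nf <;> omega)
    refine Ideal.mem_of_odd_mul_mem (n := 2 * (3 * k + 3) + 1) ⟨_, rfl⟩ ?_ h24'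
    have h3 := sub_mem h1 (J.mul_mem_left ⟨12 * k + 19, 12⟩ h24)
    convert h3 using 1
    ext <;> simp [pow_two] <;> ring

omit h24 hJ in
theorem QuadRing.twelve_mul_mem {A : Type*} [CommGroup A]
    {φ : SpecialLinearGroup (Fin 2) (QuadRing a b) →* A} (hb : b = 1) (ha : a % 2 = 0)
    (h24 : (24 : QuadRing a b) ∈ elemKerIdeal φ)
    (h : ∀ u u' : QuadRing a b, IsCoprime (QuadraticAlgebra.norm u) 6 →
      IsCoprime (QuadraticAlgebra.norm u') 6 → 3 * ((u - 1) * (u' - 1)) ∈ elemKer φ) :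
    (12 : QuadRing a b) ∈ elemKerIdeal φ := by
  subst hb
  have h0 : IsCoprime (QuadraticAlgebra.norm (-1 : QuadRing a 1)) 6 := by
    simp [isCoprime_one_left]
  have h1 := h _ _ h0 h0
  have h2 := h (-1) ⟨1, 18⟩ h0 (by
    rw [norm_apply]
    apply Int.isCoprime_six <;> simp <;> ring_nf <;> omega)
  intro x
  have h3 := sub_mem (add_mem (zsmul_mem h1 x.re) (zsmul_mem h2 x.im)) (h24 ⟨0, -5 * x.im⟩)
  convert h3 using 1
  ext <;> simp <;> ring

end QuadRing

/-- A homomorphism from `SL₂(R)^ab` to `T` which is surjective on upper triangular elementary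
matrices, and whose kernel there is killed by `n`. -/
def HasElemQuotient (R T : Type*) [CommRing R] [AddCommGroup T] (n : R) : Prop :=
  ∃ F : Additive (Abelianization (SpecialLinearGroup (Fin 2) R)) →+ T,
    (∀ t, ∃ x : R, F (.ofMul (Abelianization.of (upperElem x))) = t) ∧
    ∀ x : R, F (.ofMul (Abelianization.of (upperElem x))) = 0 →
      n * x ∈ elemKer (Abelianization.of (G := SpecialLinearGroup (Fin 2) R))

section Hom

variable {R S T : Type*} [CommRing R] [CommRing S] [AddCommGroup T]

theorem exists_abelianization_hom (hS : elemSubgroup S = ⊤)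
    (f : SpecialLinearGroup (Fin 2) S → T) (τ : S → T) (h1 : f 1 = 0)
    (hu : ∀ M x, f (M * upperElem x) = f M + τ x)
    (hl : ∀ M x, f (M * lowerElem x) = f M - τ x) (r : R →+* S) :
    ∃ F : Additive (Abelianization (SpecialLinearGroup (Fin 2) R)) →+ T,
      ∀ x, F (.ofMul (Abelianization.of (upperElem x))) = τ (r x) := by
  have hmul : ∀ N M, f (M * N) = f M + f N := by
    intro N
    have hN : N ∈ elemSubgroup S := hS ▸ Subgroup.mem_top N
    induction hN using Subgroup.closure_induction with
    | mem N hN =>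
      rcases hN with ⟨x, rfl⟩ | ⟨x, rfl⟩
      · intro M; rw [hu, ← one_mul (upperElem x), hu, h1, zero_add]
      · intro M; rw [hl, ← one_mul (lowerElem x), hl, h1, zero_sub, sub_eq_add_neg]
    | one => intro M; rw [mul_one, h1, add_zero]
    | mul N N' _ _ hN hN' => intro M; rw [← mul_assoc, hN', hN, hN', add_assoc]
    | inv N _ hN =>
      intro M
      have h2 := hN N⁻¹
      have h3 := hN (M * N⁻¹)
      rw [inv_mul_cancel, h1] at h2
      rw [inv_mul_cancel_right] at h3
      rw [h3, add_assoc, add_comm (f N), ← h2, add_zero]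
  let g : SpecialLinearGroup (Fin 2) S →* Multiplicative T :=
    { toFun := fun M => .ofAdd (f M)
      map_one' := by rw [h1]; rfl
      map_mul' := fun M N => by rw [hmul]; rfl }
  refine ⟨MonoidHom.toAdditiveLeft (Abelianization.lift (g.comp (SpecialLinearGroup.map r))),
    fun x => ?_⟩
  change f (SpecialLinearGroup.map r (upperElem x)) = _
  rw [map_upperElem, ← one_mul (upperElem _), hu, h1, zero_add]

/-- The character of `SL₂(ℤ/m)`, `m ∣ 12`, in terms of matrix entries. -/
def modTwelveChar (S : Type*) [CommRing S] (a b c d : S) : S :=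
  (1 - c ^ 2) * (b * d + 3 * (c - 1) * d + c + 3) + c * (a + d - 3)

theorem modTwelveChar_three_upper : ∀ a b c d x : ZMod 3, a * d - b * c = 1 →
    modTwelveChar _ a (a * x + b) c (c * x + d) = modTwelveChar _ a b c d + x := by
  unfold modTwelveChar; decide +kernel

theorem modTwelveChar_three_lower : ∀ a b c d x : ZMod 3, a * d - b * c = 1 →
    modTwelveChar _ (a + b * x) b (c + d * x) d = modTwelveChar _ a b c d - x := by
  unfold modTwelveChar; decide +kernel

theorem modTwelveChar_four_upper : ∀ a b c d x : ZMod 4, a * d - b * c = 1 →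
    modTwelveChar _ a (a * x + b) c (c * x + d) = modTwelveChar _ a b c d + x := by
  unfold modTwelveChar; decide +kernel

theorem modTwelveChar_four_lower : ∀ a b c d x : ZMod 4, a * d - b * c = 1 →
    modTwelveChar _ (a + b * x) b (c + d * x) d = modTwelveChar _ a b c d - x := by
  unfold modTwelveChar; decide +kernel

theorem exists_hom_three (r : R →+* ZMod 3) :
    ∃ F : Additive (Abelianization (SpecialLinearGroup (Fin 2) R)) →+ ZMod 3,
      ∀ x, F (.ofMul (Abelianization.of (upperElem x))) = r x := by
  refine exists_abelianization_hom elemSubgroup_eq_top_of_finite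
    (fun M => modTwelveChar _ (M 0 0) (M 0 1) (M 1 0) (M 1 1)) id (by decide) ?_ ?_ r
  · intro M x
    simpa [sl2_mul_apply] using modTwelveChar_three_upper _ _ _ _ x (sl2_det M)
  · intro M x
    simpa [sl2_mul_apply] using modTwelveChar_three_lower _ _ _ _ x (sl2_det M)

theorem exists_hom_four (r : R →+* ZMod 4) :
    ∃ F : Additive (Abelianization (SpecialLinearGroup (Fin 2) R)) →+ ZMod 4,
      ∀ x, F (.ofMul (Abelianization.of (upperElem x))) = r x := by
  refine exists_abelianization_hom elemSubgroup_eq_top_of_finite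
    (fun M => modTwelveChar _ (M 0 0) (M 0 1) (M 1 0) (M 1 1)) id (by decide) ?_ ?_ r
  · intro M x
    simpa [sl2_mul_apply] using modTwelveChar_four_upper _ _ _ _ x (sl2_det M)
  · intro M x
    simpa [sl2_mul_apply] using modTwelveChar_four_lower _ _ _ _ x (sl2_det M)

/-- The second component of the character of `SL₂` of the dual numbers over `ℤ/2`: the matrix
`M₀ + M₁ ε` is sent to `λ(M₀⁻¹ M₁)` where `λ` sums the entries other than the lower right one. -/
def dualChar (a₀ a₁ b₀ b₁ c₀ c₁ d₀ d₁ : ZMod 2) : ZMod 2 :=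
  d₀ * a₁ + b₀ * c₁ + d₀ * b₁ + b₀ * d₁ + c₀ * a₁ + a₀ * c₁

theorem modTwelveChar_two_upper : ∀ a b c d x : ZMod 2, a * d - b * c = 1 →
    modTwelveChar _ a (a * x + b) c (c * x + d) = modTwelveChar _ a b c d + x := by
  unfold modTwelveChar; decide +kernel

theorem modTwelveChar_two_lower : ∀ a b c d x : ZMod 2, a * d - b * c = 1 →
    modTwelveChar _ (a + b * x) b (c + d * x) d = modTwelveChar _ a b c d - x := by
  unfold modTwelveChar; decide +kernel

theorem dualChar_upper : ∀ a₀ a₁ b₀ b₁ c₀ c₁ d₀ d₁ x₀ x₁ : ZMod 2, a₀ * d₀ - b₀ * c₀ = 1 →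
    a₀ * d₁ + a₁ * d₀ - (b₀ * c₁ + b₁ * c₀) = 0 →
    dualChar a₀ a₁ (a₀ * x₀ + b₀) (a₀ * x₁ + a₁ * x₀ + b₁) c₀ c₁ (c₀ * x₀ + d₀)
      (c₀ * x₁ + c₁ * x₀ + d₁) = dualChar a₀ a₁ b₀ b₁ c₀ c₁ d₀ d₁ + x₁ := by
  unfold dualChar; decide +kernel

theorem dualChar_lower : ∀ a₀ a₁ b₀ b₁ c₀ c₁ d₀ d₁ x₀ x₁ : ZMod 2, a₀ * d₀ - b₀ * c₀ = 1 →
    a₀ * d₁ + a₁ * d₀ - (b₀ * c₁ + b₁ * c₀) = 0 →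
    dualChar (a₀ + b₀ * x₀) (a₁ + (b₀ * x₁ + b₁ * x₀)) b₀ b₁ (c₀ + d₀ * x₀)
      (c₁ + (d₀ * x₁ + d₁ * x₀)) d₀ d₁ = dualChar a₀ a₁ b₀ b₁ c₀ c₁ d₀ d₁ - x₁ := by
  unfold dualChar; decide +kernel

instance : Finite (QuadraticAlgebra (ZMod 2) 0 0) :=
  Finite.of_equiv _ (QuadraticAlgebra.equivProd (0 : ZMod 2) 0).symm

theorem exists_hom_two (r : R →+* QuadraticAlgebra (ZMod 2) 0 0) :
    ∃ F : Additive (Abelianization (SpecialLinearGroup (Fin 2) R)) →+ ZMod 2 × ZMod 2,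
      ∀ x, F (.ofMul (Abelianization.of (upperElem x))) = ((r x).re, (r x).im) := by
  refine exists_abelianization_hom elemSubgroup_eq_top_of_finite
    (fun M => (modTwelveChar _ (M 0 0).re (M 0 1).re (M 1 0).re (M 1 1).re,
      dualChar (M 0 0).re (M 0 0).im (M 0 1).re (M 0 1).im (M 1 0).re (M 1 0).im
        (M 1 1).re (M 1 1).im)) (fun x => (x.re, x.im)) ?_ ?_ ?_ r
  · simp; decide
  · intro M x
    have h0 := congrArg QuadraticAlgebra.re (sl2_det M)
    have h1 := congrArg QuadraticAlgebra.im (sl2_det M)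
    simp at h0 h1
    have h2 := modTwelveChar_two_upper _ _ _ _ x.re h0
    have h3 := dualChar_upper _ _ _ _ _ _ _ _ x.re x.im h0 h1
    simp only [sl2_mul_apply]
    ext <;> simpa
  · intro M x
    have h0 := congrArg QuadraticAlgebra.re (sl2_det M)
    have h1 := congrArg QuadraticAlgebra.im (sl2_det M)
    simp at h0 h1
    have h2 := modTwelveChar_two_lower _ _ _ _ x.re h0
    have h3 := dualChar_lower _ _ _ _ _ _ _ _ x.re x.im h0 h1
    simp only [sl2_mul_apply]
    ext <;> simpa

end Hom

theorem HasElemQuotient.of_mem {R : Type*} [CommRing R] {n : R}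
    (h : n ∈ elemKerIdeal (Abelianization.of (G := SpecialLinearGroup (Fin 2) R))) :
    HasElemQuotient R (ZMod 1) n :=
  ⟨0, fun _ => ⟨0, Subsingleton.elim _ _⟩, fun x _ => h x⟩

theorem HasElemQuotient.nonempty_addEquiv {R T T' : Type*} [CommRing R] [AddCommGroup T]
    [AddCommGroup T'] (h : HasElemQuotient R T 9) (h' : HasElemQuotient R T' 8)
    (hT : ∀ t : T, 8 • t = 0) (hT' : ∀ t : T', 9 • t = 0)
    (hR : ∀ M : SpecialLinearGroup (Fin 2) R, ∃ x,
      Abelianization.of M = Abelianization.of (upperElem x)) :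
    Nonempty (Additive (Abelianization (SpecialLinearGroup (Fin 2) R)) ≃+ T × T') := by
  obtain ⟨F, hs, hk⟩ := h
  obtain ⟨F', hs', hk'⟩ := h'
  let φ := Abelianization.of (G := SpecialLinearGroup (Fin 2) R)
  let u : R →+ Additive (Abelianization (SpecialLinearGroup (Fin 2) R)) :=
    { toFun := fun x => .ofMul (φ (upperElem x))
      map_zero' := (elemKer φ).zero_mem
      map_add' := fun x y => by
        rw [upperElem_add, map_mul]; rfl }
  have h9 : ∀ x, F (u (9 * x)) = F (u x) := fun x => by
    have : 9 * x = x + 8 • x := by simp; ring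
    rw [this, map_add, map_add, map_nsmul, map_nsmul, hT, add_zero]
  have h8 : ∀ x, F (u (8 * x)) = 0 := fun x => by
    have : 8 * x = 8 • x := by simp
    rw [this, map_nsmul, map_nsmul, hT]
  have h9' : ∀ x, F' (u (9 * x)) = 0 := fun x => by
    have : 9 * x = 9 • x := by simp
    rw [this, map_nsmul, map_nsmul, hT']
  have h8' : ∀ x, F' (u (8 * x)) = - F' (u x) := fun x => by
    have : 8 * x = 9 • x - x := by simp; ring
    rw [this, map_sub, map_sub, map_nsmul, map_nsmul, hT', zero_sub]
  refine ⟨AddEquiv.ofBijective (F.prod F') ⟨?_, ?_⟩⟩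
  · rw [injective_iff_map_eq_zero]
    intro z hz
    obtain ⟨M, hM⟩ := QuotientGroup.mk_surjective z.toMul
    obtain ⟨x, hx⟩ := hR M
    obtain rfl : u x = z := by
      rw [← ofMul_toMul z, ← hM]; exact congrArg Additive.ofMul hx.symm
    have h1 : u (9 * x) = 0 := hk x (Prod.ext_iff.1 hz).1
    have h2 : u (8 * x) = 0 := hk' x (Prod.ext_iff.1 hz).2
    have h3 : x = 9 * x - 8 * x := by ring
    rw [h3, map_sub, h1, h2, sub_zero]
  · rintro ⟨t, t'⟩
    obtain ⟨x, hx⟩ := hs t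
    obtain ⟨x', hx'⟩ := hs' t'
    change F (u x) = t at hx
    change F' (u x') = t' at hx'
    refine ⟨u (9 * x - 8 * x'), ?_⟩
    rw [map_sub, AddMonoidHom.prod_apply, map_sub, map_sub, h9, h8, h9', h8', hx, hx']
    simp

section QuadRing

open QuadraticAlgebra

variable {a b : ℤ}

theorem QuadRing.hasElemQuotient_three_ramified
    (h24 : (24 : QuadRing a b) ∈
      elemKerIdeal (Abelianization.of (G := SpecialLinearGroup (Fin 2) (QuadRing a b))))
    (hJ : ∀ u : QuadRing a b, IsCoprime (QuadraticAlgebra.norm u) 6 → u ^ 2 - 1 ∈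
      elemKerIdeal (Abelianization.of (G := SpecialLinearGroup (Fin 2) (QuadRing a b))))
    (h : (b ^ 2 + 4 * a) % 3 = 0) : HasElemQuotient (QuadRing a b) (ZMod 3) 8 := by
  have hδ := eight_mul_delta_mem h24 hJ h
  have h0 : ((b ^ 2 + 4 * a : ℤ) : ZMod 3) = 0 :=
    (ZMod.intCast_zmod_eq_zero_iff_dvd _ _).2 (by simpa using Int.dvd_of_emod_eq_zero h)
  push_cast at h0
  have h3 : (3 : ZMod 3) = 0 := rfl
  obtain ⟨F, hF⟩ := exists_hom_three (toRing (a := a) (b := b) (-b : ZMod 3)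
    (by linear_combination 2 * h0 - 3 * a * h3))
  simp only [toRing_apply] at hF
  refine ⟨F, fun t => ⟨⟨(t.val : ℤ), 0⟩, ?_⟩, fun x hx => ?_⟩
  · rw [hF]; simp
  · rw [hF] at hx
    obtain ⟨y, hy⟩ : (3 : ℤ) ∣ x.re - b * x.im :=
      (ZMod.intCast_zmod_eq_zero_iff_dvd _ 3).1 (by push_cast; linear_combination hx)
    have := sub_mem (Ideal.mul_mem_right (⟨y, x.im⟩ : QuadRing a b) _ h24)
      (Ideal.mul_mem_right (x.im : QuadRing a b) _ hδ)
    have h4 := this 1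
    rw [mul_one] at h4
    convert h4 using 1
    ext
    · simp [delta]
      linear_combination 8 * hy
    · simp [delta]
      ring

theorem QuadRing.hasElemQuotient_three_split
    (h24 : (24 : QuadRing a b) ∈
      elemKerIdeal (Abelianization.of (G := SpecialLinearGroup (Fin 2) (QuadRing a b))))
    (h : (b ^ 2 + 4 * a) % 3 = 1) :
    HasElemQuotient (QuadRing a b) (ZMod 3 × ZMod 3) 8 := by
  have h0 : ((b ^ 2 + 4 * a - 1 : ℤ) : ZMod 3) = 0 :=
    (ZMod.intCast_zmod_eq_zero_iff_dvd _ 3).2 (by omega)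
  push_cast at h0
  have h3 : (3 : ZMod 3) = 0 := rfl
  obtain ⟨F, hF⟩ := exists_hom_three (toRing (a := a) (b := b) (-b + 1 : ZMod 3)
    (by linear_combination 2 * h0 + (-3 * a - b + 1) * h3))
  obtain ⟨F', hF'⟩ := exists_hom_three (toRing (a := a) (b := b) (-b - 1 : ZMod 3)
    (by linear_combination 2 * h0 + (-3 * a + b + 1) * h3))
  simp only [toRing_apply] at hF hF'
  refine ⟨F.prod F', fun ⟨s, t⟩ => ?_, fun x hx => ?_⟩
  · refine ⟨⟨((-s - t + b * (t - s) : ZMod 3).val : ℤ), ((t - s : ZMod 3).val : ℤ)⟩, ?_⟩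
    rw [AddMonoidHom.prod_apply, hF, hF']
    simp
    constructor
    · linear_combination -s * h3
    · linear_combination -t * h3
  · rw [AddMonoidHom.prod_apply, hF, hF', Prod.mk_eq_zero] at hx
    obtain ⟨i, hi⟩ : (3 : ℤ) ∣ x.im :=
      (ZMod.intCast_zmod_eq_zero_iff_dvd _ 3).1 (by linear_combination hx.2 - hx.1 + x.im * h3)
    obtain ⟨j, hj⟩ : (3 : ℤ) ∣ x.re :=
      (ZMod.intCast_zmod_eq_zero_iff_dvd _ 3).1 (by
        have := hx.1; rw [hi] at this; push_cast at this
        linear_combination this - (-b+1) * i * h3)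
    convert h24 ⟨j, i⟩ using 1
    ext <;> simp [hi, hj] <;> ring

theorem QuadRing.hasElemQuotient_four (hb : b = 1) (ha : a % 2 = 0)
    (h12 : (12 : QuadRing a b) ∈
      elemKerIdeal (Abelianization.of (G := SpecialLinearGroup (Fin 2) (QuadRing a b)))) :
    HasElemQuotient (QuadRing a b) (ZMod 4 × ZMod 4) 9 := by
  subst hb
  obtain ⟨k, rfl⟩ : ∃ k, a = 2 * k := ⟨a / 2, by omega⟩
  have h4 : (4 : ZMod 4) = 0 := rfl
  obtain ⟨F, hF⟩ := exists_hom_four (toRing (a := 2 * k) (b := 1) (2 * k : ZMod 4)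
    (by push_cast; linear_combination (k * k - k) * h4))
  obtain ⟨F', hF'⟩ := exists_hom_four (toRing (a := 2 * k) (b := 1) (1 - 2 * k : ZMod 4)
    (by push_cast; linear_combination (k * k - k) * h4))
  simp only [toRing_apply] at hF hF'
  refine ⟨F.prod F', fun ⟨s, t⟩ => ?_, fun x hx => ?_⟩
  · refine ⟨⟨((s - 2 * k * (t - s) : ZMod 4).val : ℤ), ((t - s : ZMod 4).val : ℤ)⟩, ?_⟩
    rw [AddMonoidHom.prod_apply, hF, hF']
    simp
    constructor
    · ring
    · linear_combination -k * (t - s) * h4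
  · rw [AddMonoidHom.prod_apply, hF, hF', Prod.mk_eq_zero] at hx
    obtain ⟨i, hi⟩ : (4 : ℤ) ∣ x.im :=
      (ZMod.intCast_zmod_eq_zero_iff_dvd _ 4).1 (by
        linear_combination hx.2 - hx.1 + k * x.im * h4)
    obtain ⟨j, hj⟩ : (4 : ℤ) ∣ x.re :=
      (ZMod.intCast_zmod_eq_zero_iff_dvd _ 4).1 (by
        have := hx.1; rw [hi] at this; push_cast at this
        linear_combination this - 2 * k * i * h4)
    convert h12 ⟨3 * j, 3 * i⟩ using 1
    ext <;> simp [hi, hj] <;> ring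

theorem QuadRing.hasElemQuotient_two (hb : b = 0)
    (h6 : (6 : QuadRing a b) ∈
      elemKerIdeal (Abelianization.of (G := SpecialLinearGroup (Fin 2) (QuadRing a b)))) :
    HasElemQuotient (QuadRing a b) (ZMod 2 × ZMod 2) 9 := by
  subst hb
  have h2 : (2 : ZMod 2) = 0 := rfl
  obtain ⟨r, hr⟩ : ∃ r : ZMod 2, r * r = a := ⟨a, by
    generalize (a : ZMod 2) = r; revert r; decide⟩
  obtain ⟨F, hF⟩ := exists_hom_two (toRing (a := a) (b := 0)
    (⟨r, 1⟩ : QuadraticAlgebra (ZMod 2) 0 0) (by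
      ext
      · simp [hr]
      · simp; linear_combination r * h2))
  replace hF : ∀ x : QuadRing a 0, F (.ofMul (Abelianization.of (upperElem x))) =
      ((x.re : ZMod 2) + x.im * r, (x.im : ZMod 2)) := fun x => by
    rw [hF, toRing_apply]
    simp
  refine ⟨F, fun ⟨s, t⟩ => ?_, fun x hx => ?_⟩
  · refine ⟨⟨((s - t * r : ZMod 2).val : ℤ), (t.val : ℤ)⟩, ?_⟩
    rw [hF]
    simp
  · rw [hF, Prod.mk_eq_zero] at hx
    obtain ⟨i, hi⟩ : (2 : ℤ) ∣ x.im := (ZMod.intCast_zmod_eq_zero_iff_dvd _ 2).1 hx.2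
    obtain ⟨j, hj⟩ : (2 : ℤ) ∣ x.re :=
      (ZMod.intCast_zmod_eq_zero_iff_dvd _ 2).1 (by linear_combination hx.1 - r * hx.2)
    convert h6 ⟨3 * j, 3 * i⟩ using 1
    ext <;> simp [hi, hj] <;> ring

end QuadRing

theorem IsDedekindDomain.exists_pow_eq_span {R : Type*} [CommRing R] [IsDedekindDomain R]
    [Finite (ClassGroup R)] {I : Ideal R} (hI : I ≠ ⊥) :
    ∃ g, I ^ Nat.card (ClassGroup R) = Ideal.span {g} := by
  have hI' := mem_nonZeroDivisors_of_ne_zero hI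
  have h1 : ClassGroup.mk0 ⟨I, hI'⟩ ^ Nat.card (ClassGroup R) = 1 := pow_card_eq_one'
  rw [← map_pow, SubmonoidClass.mk_pow, ClassGroup.mk0_eq_one_iff] at h1
  exact h1.principal

theorem QuadRing.elemKer_facts_of_isIntegralClosure {a b : ℤ} (K : Type*) [Field K] [NumberField K]
    [Algebra (QuadRing a b) K] [IsIntegralClosure (QuadRing a b) ℤ K]
    (hpos : 0 < b ^ 2 + 4 * a) (hns : ¬ IsSquare (b ^ 2 + 4 * a))
    {A : Type*} [CommGroup A] (φ : SpecialLinearGroup (Fin 2) (QuadRing a b) →* A) :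
    (∀ M, ∃ x, φ M = φ (upperElem x)) ∧
    (24 : QuadRing a b) ∈ elemKerIdeal φ ∧
    (∀ u, IsCoprime (QuadraticAlgebra.norm u) 6 → u ^ 2 - 1 ∈ elemKerIdeal φ) ∧
    (∀ u u', IsCoprime (QuadraticAlgebra.norm u) 6 → IsCoprime (QuadraticAlgebra.norm u') 6 →
      3 * ((u - 1) * (u' - 1)) ∈ elemKer φ) := by
  have := isDomain hns
  have := IsIntegralClosure.isDedekindDomain ℤ ℚ K (QuadRing a b)
  have := ClassGroup.fintypeOfAdmissibleOfFinite (S := QuadRing a b) ℚ K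
    AbsoluteValue.absIsAdmissible
  exact elemKer_facts hpos hns Nat.card_pos (fun I hI => IsDedekindDomain.exists_pow_eq_span hI) φ

theorem exists_int_of_squarefree_mul_sq {d n : ℤ} (hd : Squarefree d) {q : ℚ} (h : d * q ^ 2 = n) :
    ∃ l : ℤ, q = l := by
  have h0 : (q.den : ℚ) ≠ 0 := by simp
  have h1 : d * q.num ^ 2 = n * (q.den : ℤ) ^ 2 := by
    rw [← Rat.num_div_den q] at h
    field_simp at h
    rw [mul_comm n]
    exact_mod_cast h
  have h2 : IsCoprime ((q.den : ℤ) ^ 2) (q.num ^ 2) :=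
    (Rat.isCoprime_num_den q).symm.pow
  have h3 : (q.den : ℤ) * q.den ∣ d := by
    rw [← pow_two]
    exact h2.dvd_of_dvd_mul_right (Dvd.intro_left n h1.symm)
  have h4 := hd _ h3
  rw [Int.ofNat_isUnit, Nat.isUnit_iff] at h4
  exact ⟨q.num, (Rat.den_eq_one_iff q).1 h4 |>.symm⟩

theorem not_isSquare_of_squarefree {d : ℕ} (hd1 : 1 < d) (hd : Squarefree d) : ¬ IsSquare d := by
  rintro ⟨r, rfl⟩
  have h := Nat.isUnit_iff.1 (hd r dvd_rfl)
  simp [h] at hd1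

section Field

variable {d : ℕ} (hd1 : 1 < d) (hd : Squarefree d) {K : Type*} [Field K] [NumberField K]
  {α : K} (hα : α ^ 2 = (d : K))

include hd1 hd hα

theorem eq_zero_of_add_mul_sqrt {s t : ℚ} (h : (s : K) + t * α = 0) : s = 0 ∧ t = 0 := by
  have ht : t = 0 := by
    by_contra ht
    have ht' : (t : K) ≠ 0 := by exact_mod_cast ht
    have h1 : (((s / t) ^ 2 : ℚ) : K) = ((d : ℚ) : K) := by
      push_cast
      rw [← hα]
      field_simp
      linear_combination (s - t * α) * h
    have h2 : (s / t) ^ 2 = d := by exact_mod_cast h1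
    obtain ⟨l, hl⟩ := exists_int_of_squarefree_mul_sq (d := 1) (n := d) squarefree_one
      (q := s / t) (by push_cast; rw [one_mul, h2])
    rw [hl] at h2
    have h3 : l ^ 2 = d := by exact_mod_cast h2
    apply not_isSquare_of_squarefree hd1 hd
    exact ⟨l.natAbs, by zify; rw [← h3]; simp [pow_two]⟩
  subst ht
  simp at h
  exact ⟨h, rfl⟩

theorem linearIndependent_one_sqrt : LinearIndependent ℚ ![1, α] := by
  rw [LinearIndependent.pair_iff]
  intro s t h
  rw [Algebra.smul_def, Algebra.smul_def, mul_one] at h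
  exact eq_zero_of_add_mul_sqrt hd1 hd hα h

theorem exists_eq_add_mul_sqrt (hdeg : Module.finrank ℚ K = 2) (x : K) :
    ∃ p q : ℚ, x = p + q * α := by
  have h := (linearIndependent_one_sqrt hd1 hd hα).span_eq_top_of_card_eq_finrank' (by simp [hdeg])
  have hx : x ∈ Submodule.span ℚ (Set.range ![1, α]) := h ▸ Submodule.mem_top
  simp only [Matrix.range_cons, Matrix.range_empty, Set.union_empty, Set.singleton_union] at hx
  obtain ⟨p, q, h⟩ := Submodule.mem_span_pair.1 hx
  exact ⟨p, q, by rw [← h, Algebra.smul_def, Algebra.smul_def]; simp⟩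

open Polynomial in
theorem exists_trace_norm_of_isIntegral {p q : ℚ} (h : IsIntegral ℤ (p + q * α)) :
    ∃ m n : ℤ, 2 * p = m ∧ p ^ 2 - d * q ^ 2 = n := by
  by_cases hq : q = 0
  · subst hq
    have h1 : IsIntegral ℤ (algebraMap ℚ K p) := by simpa using h
    rw [isIntegral_algebraMap_iff (algebraMap ℚ K).injective,
      IsIntegrallyClosed.isIntegral_iff] at h1
    obtain ⟨y, hy⟩ := h1
    exact ⟨2 * y, y ^ 2, by simp [← hy], by simp [← hy]⟩
  · obtain ⟨x, hx⟩ : ∃ x : K, x = p + q * α := ⟨_, rfl⟩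
    rw [← hx] at h
    obtain ⟨c, hc⟩ : ∃ c : ℚ, c = -(2 * p) := ⟨_, rfl⟩
    obtain ⟨e, he⟩ : ∃ e : ℚ, e = p ^ 2 - d * q ^ 2 := ⟨_, rfl⟩
    set f : ℚ[X] := X ^ 2 + (C c * X + C e) with hf
    have hfm : f.Monic := monic_X_pow_add degree_linear_lt
    have hfd : f.natDegree = 2 := by rw [hf]; compute_degree!
    have hfx : aeval x f = 0 := by
      simp [hf, hx, hc, he]
      linear_combination q ^ 2 * hα
    have hxi : IsIntegral ℚ x := h.tower_top
    have h2 := (minpoly.two_le_natDegree_iff hxi).2 (by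
      rintro ⟨y, hy⟩
      rw [hx, eq_ratCast] at hy
      exact hq (eq_zero_of_add_mul_sqrt hd1 hd hα (s := p - y) (t := q) (by
        push_cast
        linear_combination -hy)).2)
    have h3 : f = minpoly ℚ x := eq_of_monic_of_dvd_of_natDegree_le (minpoly.monic hxi) hfm
      (minpoly.dvd _ _ hfx) (by rw [hfd]; exact h2)
    rw [minpoly.isIntegrallyClosed_eq_field_fractions' ℚ h] at h3
    have h4 := congrArg (coeff · 1) h3
    have h5 := congrArg (coeff · 0) h3
    simp [hf, coeff_X] at h4 h5
    exact ⟨-(minpoly ℤ x).coeff 1, (minpoly ℤ x).coeff 0, by push_cast; linarith, by rw [← he, h5]⟩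

theorem exists_int_of_isIntegral {p q : ℚ} (h : IsIntegral ℤ (p + q * α)) :
    ∃ m l : ℤ, 2 * p = m ∧ 2 * q = l ∧ (4 : ℤ) ∣ m ^ 2 - d * l ^ 2 := by
  obtain ⟨m, n, hm, hn⟩ := exists_trace_norm_of_isIntegral hd1 hd hα h
  obtain ⟨l, hl⟩ := exists_int_of_squarefree_mul_sq (d := d) (n := m ^ 2 - 4 * n) (q := 2 * q)
    (Int.squarefree_natCast.2 hd) (by push_cast; rw [← hm, ← hn]; ring)
  refine ⟨m, l, hm, hl, n, ?_⟩
  have : ((m ^ 2 - d * l ^ 2 : ℤ) : ℚ) = (4 * n : ℤ) := by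
    push_cast; rw [← hm, ← hn, ← hl]; ring
  exact_mod_cast this

theorem QuadRing.toRing_injective {a b : ℤ} {s t : ℚ} (ht : t ≠ 0)
    (hr : (s + t * α) * (s + t * α) = a + b * (s + t * α)) :
    Function.Injective (toRing (s + t * α) hr) := by
  rw [injective_iff_map_eq_zero]
  intro x hx
  rw [toRing_apply] at hx
  have := eq_zero_of_add_mul_sqrt hd1 hd hα (s := x.re + x.im * s) (t := x.im * t) (by
    push_cast
    linear_combination hx)
  have him : x.im = 0 := by simpa [ht] using this.2
  ext
  · simpa [him] using this.1
  · exact him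

theorem QuadRing.isIntegralClosure_toRing {a b : ℤ} (hdeg : Module.finrank ℚ K = 2)
    {s t : ℚ} (ht : t ≠ 0) (hr : (s + t * α) * (s + t * α) = a + b * (s + t * α))
    (hi : ∀ m l : ℤ, (4 : ℤ) ∣ m ^ 2 - d * l ^ 2 →
      ∃ i j : ℤ, (m / 2 : ℚ) = i + j * s ∧ (l / 2 : ℚ) = j * t) :
    let := (toRing (s + t * α) hr).toAlgebra
    IsIntegralClosure (QuadRing a b) ℤ K := by
  let := (toRing (s + t * α) hr).toAlgebra
  refine ⟨toRing_injective hd1 hd hα ht hr, fun {x} => ⟨fun hx => ?_, ?_⟩⟩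
  · obtain ⟨p, q, rfl⟩ := exists_eq_add_mul_sqrt hd1 hd hα hdeg x
    obtain ⟨m, l, hm, hl, h4⟩ := exists_int_of_isIntegral hd1 hd hα hx
    obtain ⟨i, j, h1, h2⟩ := hi m l h4
    refine ⟨⟨i, j⟩, ?_⟩
    change toRing _ hr _ = _
    have hp : p = i + j * s := by rw [← h1, ← hm]; ring
    have hq : q = j * t := by rw [← h2, ← hl]; ring
    rw [toRing_apply, hp, hq]
    push_cast
    ring
  · rintro ⟨y, rfl⟩
    exact map_isIntegral_int (algebraMap (QuadRing a b) K) (Algebra.IsIntegral.isIntegral y)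

end Field

/-- A ring isomorphism induces an isomorphism on abelianizations of `SL₂`. -/
def SL2ab.congr {R S : Type*} [CommRing R] [CommRing S] (e : R ≃+* S) : SL2ab R ≃+ SL2ab S :=
  MulEquiv.toAdditive <| MulEquiv.abelianizationCongr <|
    MonoidHom.toMulEquiv (SpecialLinearGroup.map (e : R →+* S))
      (SpecialLinearGroup.map (e.symm : S →+* R))
      (by ext; simp) (by ext; simp)

theorem QuadRing.nonempty_SL2ab_equiv {a b : ℤ} (K : Type*) [Field K] [NumberField K]
    [Algebra (QuadRing a b) K] [IsIntegralClosure (QuadRing a b) ℤ K]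
    (hpos : 0 < b ^ 2 + 4 * a) (hns : ¬ IsSquare (b ^ 2 + 4 * a)) {T T' : Type*} [AddCommGroup T]
    [AddCommGroup T']
    (h : HasElemQuotient (QuadRing a b) T 9) (h' : HasElemQuotient (QuadRing a b) T' 8)
    (hT : ∀ t : T, 8 • t = 0) (hT' : ∀ t : T', 9 • t = 0) :
    Nonempty (SL2ab (𝓞 K) ≃+ T × T') := by
  obtain ⟨e⟩ := h.nonempty_addEquiv h' hT hT'
    (elemKer_facts_of_isIntegralClosure K hpos hns _).1
  exact ⟨(SL2ab.congr (RingOfIntegers.equiv (QuadRing a b))).trans e⟩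

theorem squarefree_mod_four_ne_zero {d : ℕ} (hd : Squarefree d) : d % 4 ≠ 0 := fun h => by
  have := Nat.isUnit_iff.1 (hd 2 (Nat.dvd_of_mod_eq_zero h))
  omega

section Field

variable {d : ℕ} (hd1 : 1 < d) (hd : Squarefree d) {K : Type*} [Field K] [NumberField K]
  (hdeg : Module.finrank ℚ K = 2) {α : K} (hα : α ^ 2 = (d : K))

include hd1 hd hdeg hα

theorem exists_isIntegralClosure_of_one_mod_four (h : d % 4 = 1) :
    ∃ _ : Algebra (QuadRing (d / 4 : ℕ) 1) K, IsIntegralClosure (QuadRing (d / 4 : ℕ) 1) ℤ K := by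
  have hd4 : 4 * (d / 4) + 1 = d := by omega
  generalize d / 4 = a at *
  have hdK : 4 * (a : K) + 1 = d := by exact_mod_cast hd4
  refine ⟨_, QuadRing.isIntegralClosure_toRing hd1 hd hα hdeg (s := 1 / 2) (t := 1 / 2)
    (by norm_num) (by push_cast; linear_combination (1 / 4) * hα - (1 / 4) * hdK) ?_⟩
  intro m l h4
  have h5 : (2 : ℤ) ∣ m - l := by
    rw [← hd4] at h4
    have h6 : (2 : ℤ) ∣ (m - l) ^ 2 := by
      obtain ⟨c, hc⟩ := h4
      push_cast at hc
      exact ⟨2 * c + 2 * a * l ^ 2 + l ^ 2 - m * l, by linear_combination hc⟩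
    exact Int.prime_two.dvd_of_dvd_pow h6
  obtain ⟨i, hi⟩ := h5
  have hm : m = 2 * i + l := by linarith
  refine ⟨i, l, ?_, ?_⟩
  · rw [hm]; push_cast; ring
  · ring

theorem exists_isIntegralClosure_of_two_or_three_mod_four (h : d % 4 = 2 ∨ d % 4 = 3) :
    ∃ _ : Algebra (QuadRing d 0) K, IsIntegralClosure (QuadRing d 0) ℤ K := by
  refine ⟨_, QuadRing.isIntegralClosure_toRing hd1 hd hα hdeg (s := 0) (t := 1)
    (by norm_num) (by push_cast; linear_combination hα) ?_⟩
  intro m l h4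
  have h5 : Even m ∧ Even l := by
    have key : ∀ D m l : ZMod 4, D = 2 ∨ D = 3 → m ^ 2 - D * l ^ 2 = 0 → 2 * m = 0 ∧ 2 * l = 0 := by
      decide
    have hD : (d : ZMod 4) = 2 ∨ (d : ZMod 4) = 3 := by
      rw [← ZMod.natCast_mod d 4]
      rcases h with h | h <;> rw [h] <;> simp
    have h6 := key d m l hD (by exact_mod_cast (ZMod.intCast_zmod_eq_zero_iff_dvd _ 4).2 h4)
    have h7 : ∀ n : ℤ, 2 * (n : ZMod 4) = 0 → Even n := fun n hn => by
      have := (ZMod.intCast_zmod_eq_zero_iff_dvd (2 * n) 4).1 (by exact_mod_cast hn)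
      rw [Int.even_iff]
      omega
    exact ⟨h7 _ h6.1, h7 _ h6.2⟩
  obtain ⟨⟨i, rfl⟩, ⟨j, rfl⟩⟩ := h5
  exact ⟨i, j, by push_cast; ring, by push_cast; ring⟩

theorem exists_isIntegralClosure (h4 : d % 4 ≠ 0) :
    ∃ a b : ℤ, (d % 4 = 1 ∧ b = 1 ∧ 4 * a + 1 = d ∨ d % 4 ≠ 1 ∧ b = 0 ∧ a = d) ∧
      0 < b ^ 2 + 4 * a ∧ ¬ IsSquare (b ^ 2 + 4 * a) ∧
      ∃ _ : Algebra (QuadRing a b) K, IsIntegralClosure (QuadRing a b) ℤ K := by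
  have hsq : ¬ IsSquare (d : ℤ) := fun h =>
    not_isSquare_of_squarefree hd1 hd (Int.isSquare_natCast_iff.1 h)
  by_cases h : d % 4 = 1
  · refine ⟨(d / 4 : ℕ), 1, .inl ⟨h, rfl, by omega⟩, by omega, ?_,
      exists_isIntegralClosure_of_one_mod_four hd1 hd hdeg hα h⟩
    have : (1 : ℤ) ^ 2 + 4 * (d / 4 : ℕ) = d := by omega
    rwa [this]
  · refine ⟨d, 0, .inr ⟨h, rfl, rfl⟩, by omega, ?_,
      exists_isIntegralClosure_of_two_or_three_mod_four hd1 hd hdeg hα (by omega)⟩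
    rintro ⟨r, hr⟩
    have h2 : Even r := by
      have : Even (r * r) := ⟨2 * d, by rw [← hr]; ring⟩
      simpa [Int.even_mul] using this
    obtain ⟨k, rfl⟩ := h2
    exact hsq ⟨k, by linarith⟩

theorem exists_hasElemQuotient :
    ∃ (R : Type) (_ : CommRing R),
      (d % 3 = 2 → HasElemQuotient R (ZMod 1) 8) ∧
      (d % 3 = 0 → HasElemQuotient R (ZMod 3) 8) ∧
      (d % 3 = 1 → HasElemQuotient R (ZMod 3 × ZMod 3) 8) ∧
      (d % 8 = 5 → HasElemQuotient R (ZMod 1) 9) ∧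
      (d % 8 = 1 → HasElemQuotient R (ZMod 4 × ZMod 4) 9) ∧
      (d % 4 ≠ 1 → HasElemQuotient R (ZMod 2 × ZMod 2) 9) ∧
      ∀ (T T' : Type) [AddCommGroup T] [AddCommGroup T'], HasElemQuotient R T 9 →
        HasElemQuotient R T' 8 → (∀ t : T, 8 • t = 0) → (∀ t : T', 9 • t = 0) →
        Nonempty (SL2ab (𝓞 K) ≃+ T × T') := by
  have h4 : d % 4 ≠ 0 := squarefree_mod_four_ne_zero hd
  obtain ⟨a, b, hab, hpos, hns, _, _⟩ := exists_isIntegralClosure hd1 hd hdeg hα h4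
  obtain ⟨-, h24, hJ, hlin⟩ := QuadRing.elemKer_facts_of_isIntegralClosure K hpos hns
    (Abelianization.of (G := SpecialLinearGroup (Fin 2) (QuadRing a b)))
  have hΔ (n : ℕ) (h : d % 3 = n) : (b ^ 2 + 4 * a) % 3 = n := by
    rcases hab with ⟨-, rfl, h⟩ | ⟨-, rfl, h⟩ <;> omega
  have hb (h : d % 4 = 1) : b = 1 ∧ 4 * a + 1 = d := by
    rcases hab with h' | h'
    · exact h'.2
    · exact absurd h h'.1
  have hb' (h : d % 4 ≠ 1) : b = 0 ∧ a = d := by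
    rcases hab with h' | h'
    · exact absurd h'.1 h
    · exact h'.2
  clear hab
  refine ⟨QuadRing a b, inferInstance, fun h => ?_, fun h => ?_, fun h => ?_, fun h => ?_,
    fun h => ?_, fun h => ?_, fun T T' _ _ => QuadRing.nonempty_SL2ab_equiv K hpos hns⟩
  · exact .of_mem (QuadRing.eight_mem h24 hJ (hΔ _ h))
  · exact QuadRing.hasElemQuotient_three_ramified h24 hJ (hΔ _ h)
  · exact QuadRing.hasElemQuotient_three_split h24 (hΔ _ h)
  · obtain ⟨rfl, ha⟩ := hb (by omega)
    have h3 := QuadRing.three_mem h24 hJ rfl (by omega)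
    refine .of_mem ?_
    convert Ideal.mul_mem_left _ 3 h3 using 1
    norm_num
  · obtain ⟨rfl, ha⟩ := hb (by omega)
    have ha' : a % 2 = 0 := by omega
    exact QuadRing.hasElemQuotient_four rfl ha' (QuadRing.twelve_mul_mem rfl ha' h24 hlin)
  · obtain ⟨rfl, ha⟩ := hb' h
    exact QuadRing.hasElemQuotient_two rfl (QuadRing.six_mem h24 hJ rfl (by omega))

end Field

theorem sl2_abelianization_real_quadratic
    (d : ℕ) (hd1 : 1 < d) (hd : Squarefree d)
    (K : Type*) [Field K] [NumberField K]
    (hdeg : Module.finrank ℚ K = 2)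
    (α : K) (hα : α ^ 2 = (d : K)) :
    (d % 24 = 5 → Nonempty (SL2ab (𝓞 K) ≃+ ZMod 1)) ∧
    (d % 24 = 1 → Nonempty (SL2ab (𝓞 K) ≃+ ((ZMod 4 × ZMod 4) × (ZMod 3 × ZMod 3)))) ∧
    (d % 24 = 9 → Nonempty (SL2ab (𝓞 K) ≃+ ((ZMod 4 × ZMod 4) × ZMod 3))) ∧
    (d % 24 = 13 → Nonempty (SL2ab (𝓞 K) ≃+ (ZMod 3 × ZMod 3))) ∧
    (d % 24 = 21 → Nonempty (SL2ab (𝓞 K) ≃+ ZMod 3)) ∧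
    (d % 24 = 17 → Nonempty (SL2ab (𝓞 K) ≃+ (ZMod 4 × ZMod 4))) ∧
    (d % 24 ∈ ({2, 11, 14, 20, 23} : Set ℕ) →
      Nonempty (SL2ab (𝓞 K) ≃+ (ZMod 2 × ZMod 2))) ∧
    (d % 24 ∈ ({4, 7, 10, 19, 22} : Set ℕ) →
      Nonempty (SL2ab (𝓞 K) ≃+ ((ZMod 2 × ZMod 2) × (ZMod 3 × ZMod 3)))) ∧
    (d % 24 ∉ ({5, 1, 9, 13, 21, 17, 2, 11, 14, 20, 23, 4, 7, 10, 19, 22} : Set ℕ) →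
      Nonempty (SL2ab (𝓞 K) ≃+ ((ZMod 2 × ZMod 2) × ZMod 3))) := by
  have h4 : d % 4 ≠ 0 := squarefree_mod_four_ne_zero hd
  obtain ⟨R, _, three_trivial, three_cyclic, three_square, two_trivial, two_four, two_two, key⟩ :=
    exists_hasElemQuotient hd1 hd hdeg hα
  refine ⟨fun h => ?_, fun h => ?_, fun h => ?_, fun h => ?_, fun h => ?_, fun h => ?_,
    fun h => ?_, fun h => ?_, fun h => ?_⟩
  · exact (key _ _ (two_trivial (by omega))
      (three_trivial (by omega)) (by decide) (by decide)).map (·.trans AddEquiv.prodUnique)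
  · exact key _ _ (two_four (by omega))
      (three_square (by omega)) (by decide) (by decide)
  · exact key _ _ (two_four (by omega))
      (three_cyclic (by omega)) (by decide) (by decide)
  · exact (key _ _ (two_trivial (by omega))
      (three_square (by omega)) (by decide) (by decide)).map (·.trans AddEquiv.uniqueProd)
  · exact (key _ _ (two_trivial (by omega))
      (three_cyclic (by omega)) (by decide) (by decide)).map (·.trans AddEquiv.uniqueProd)
  · exact (key _ _ (two_four (by omega))
      (three_trivial (by omega)) (by decide) (by decide)).map (·.trans AddEquiv.prodUnique)
  · simp only [Set.mem_insert_iff, Set.mem_singleton_iff] at h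
    exact (key _ _ (two_two (by omega))
      (three_trivial (by omega)) (by decide) (by decide)).map (·.trans AddEquiv.prodUnique)
  · simp only [Set.mem_insert_iff, Set.mem_singleton_iff] at h
    exact key _ _ (two_two (by omega))
      (three_square (by omega)) (by decide) (by decide)
  · simp only [Set.mem_insert_iff, Set.mem_singleton_iff, not_or] at h
    exact key _ _ (two_two (by omega))
      (three_cyclic (by omega)) (by decide) (by decide)
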